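/- arXiv:2510.09834 — 3 statements merged into one kernel-verified Lean document; each statement's English description precedes it below -/
import Mathlib

section
/- Let ι₁ and ι₂ be nonempty finite index sets and let ρ be a density matrix on ℂ^{ι₁×ι₂}. Define its marginals ρ₁(a,a') = ∑_{b∈ι₂} ρ((a,b),(a',b)) and ρ₂(b,b') = ∑_{a∈ι₁} ρ((a,b),(a,b')), and set σ := ρ₁ ⊗ ρ₂ (Kronecker product), a density matrix on ℂ^{ι₁×ι₂}. Let ℰ_σ be the pinching map with respect to σ and ν₁ the number of distinct eigenvalues of σ. Fix reals R, R_S > 0 and α ∈ (0, 1/2). Let Π := ∑_{λ ≥ 0} P_λ be the spectral projection onto the nonnegative eigenvalues of the Hermitian matrix ℰ_σ(ρ) − 2^{R+R_S}·σ = ∑_λ λ P_λ. Then Tr[(I − Π) ρ] ≤ ν₁^α · 2^{α(R+R_S)} · Tr[(σ^{α/(2(1−α))} ρ σ^{α/(2(1−α))})^{1−α}], i.e. Tr[(I − Π) ρ] ≤ ν₁^α · 2^{α[R + R_S − D̃_{1−α}(ρ‖σ)]}. -/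
open Matrix BigOperators
open scoped ComplexOrder

noncomputable section

variable {n : Type*} [Fintype n] [DecidableEq n]

/-- Real power with the convention `0 ^ r = 0`. -/
def rpow0 (x r : ℝ) : ℝ := if x = 0 then 0 else Real.rpow x r

/-- Matrix power by the spectral functional calculus (with `0 ^ r = 0` on the kernel),
for Hermitian matrices; junk value `0` otherwise. -/
def matPow (M : Matrix n n ℂ) (r : ℝ) : Matrix n n ℂ :=
  if h : M.IsHermitian then
    (h.eigenvectorUnitary : Matrix n n ℂ) *
      Matrix.diagonal (fun i => (rpow0 (h.eigenvalues i) r : ℂ)) *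
      star (h.eigenvectorUnitary : Matrix n n ℂ)
  else 0

/-- A density matrix: positive semidefinite with unit trace. -/
def IsDensityMatrix (M : Matrix n n ℂ) : Prop := M.PosSemidef ∧ M.trace = 1

/-- Number of distinct eigenvalues of a Hermitian matrix (junk value `0` otherwise). -/
def nEig (M : Matrix n n ℂ) : ℕ :=
  if h : M.IsHermitian then (Finset.univ.image h.eigenvalues).card else 0

/-- The spectral projection of a Hermitian matrix onto the eigenspace of `t`. -/
def spectralProj (M : Matrix n n ℂ) (h : M.IsHermitian) (t : ℝ) : Matrix n n ℂ :=
  (h.eigenvectorUnitary : Matrix n n ℂ) *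
    Matrix.diagonal (fun i => if h.eigenvalues i = t then (1 : ℂ) else 0) *
    star (h.eigenvectorUnitary : Matrix n n ℂ)

/-- The pinching map with respect to a Hermitian matrix `A`:
`ℰ_A(B) = ∑_λ P_λ B P_λ` over the distinct eigenvalues `λ` of `A`. -/
def pinch (A B : Matrix n n ℂ) : Matrix n n ℂ :=
  if h : A.IsHermitian then
    ∑ t ∈ Finset.univ.image h.eigenvalues,
      spectralProj A h t * B * spectralProj A h t
  else B

/-- The spectral projection of a Hermitian matrix onto its nonnegative eigenvalues,
`Π = ∑_{λ ≥ 0} P_λ` (junk value `0` for non-Hermitian matrices). -/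
def posProj (M : Matrix n n ℂ) : Matrix n n ℂ :=
  if h : M.IsHermitian then
    (h.eigenvectorUnitary : Matrix n n ℂ) *
      Matrix.diagonal (fun i => if 0 ≤ h.eigenvalues i then (1 : ℂ) else 0) *
      star (h.eigenvectorUnitary : Matrix n n ℂ)
  else 0

/-- The sandwiched Rényi divergence
`D̃_α(ρ‖σ) = (1/(α−1)) log₂ Tr[(σ^{(1−α)/(2α)} ρ σ^{(1−α)/(2α)})^α]`. -/
def sandwichedRenyi (α : ℝ) (ρ σ : Matrix n n ℂ) : ℝ :=
  (1 / (α - 1)) *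
    Real.logb 2
      ((matPow (matPow σ ((1 - α) / (2 * α)) * ρ * matPow σ ((1 - α) / (2 * α))) α).trace.re)

/-- Fidelity `F(ρ,σ) = Tr[(σ^{1/2} ρ σ^{1/2})^{1/2}]`. -/
def fidelity (ρ σ : Matrix n n ℂ) : ℝ :=
  (matPow (matPow σ (1/2) * ρ * matPow σ (1/2)) (1/2)).trace.re

/-- Purified distance `P(ρ,σ) = √(1 − F(ρ,σ)²)`. -/
def purifiedDist (ρ σ : Matrix n n ℂ) : ℝ :=
  Real.sqrt (1 - (fidelity ρ σ) ^ 2)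

/-- Base-two matrix logarithm by spectral functional calculus (`0 ↦ 0` on the kernel). -/
def matLog2 (M : Matrix n n ℂ) : Matrix n n ℂ :=
  if h : M.IsHermitian then
    (h.eigenvectorUnitary : Matrix n n ℂ) *
      Matrix.diagonal (fun i => (Real.logb 2 (h.eigenvalues i) : ℂ)) *
      star (h.eigenvectorUnitary : Matrix n n ℂ)
  else 0

/-- Quantum relative entropy `D(ρ‖σ) = Tr[ρ (log₂ ρ − log₂ σ)]`. -/
def relEntropy (ρ σ : Matrix n n ℂ) : ℝ :=
  (ρ * (matLog2 ρ - matLog2 σ)).trace.re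


end

open scoped Kronecker

namespace Matrix

section SpectralCalculus

variable {n : Type*} [Fintype n] [DecidableEq n]

/-- Commuting Hermitian matrices are simultaneously diagonalizable by a unitary. -/
theorem IsHermitian.exists_unitary_diagonal_of_commute {A B : Matrix n n ℂ}
    (hA : A.IsHermitian) (hB : B.IsHermitian) (hAB : Commute A B) :
    ∃ U ∈ unitaryGroup n ℂ, ∃ a b : n → ℝ,
      A = U * diagonal (fun i => (a i : ℂ)) * star U ∧
      B = U * diagonal (fun i => (b i : ℂ)) * star U := by
  have hSA := isSymmetric_toEuclideanLin_iff.mpr hA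
  have hSB := isSymmetric_toEuclideanLin_iff.mpr hB
  set S := toEuclideanLin A with hS
  set T := toEuclideanLin B with hT
  have hST : Commute S T := by
    refine LinearMap.ext fun v => ?_
    simp only [hS, hT, Module.End.mul_apply, toLpLin_apply, mulVec_mulVec, hAB.eq]
  let V : Module.End.Eigenvalues T × Module.End.Eigenvalues S →
      Submodule ℂ (EuclideanSpace ℂ n) :=
    fun i => Module.End.eigenspace S i.2 ⊓ Module.End.eigenspace T i.1
  have hV' : OrthogonalFamily ℂ (fun i => V i) fun i => (V i).subtypeₗᵢ :=
    (LinearMap.IsSymmetric.orthogonalFamily_eigenspace_inf_eigenspace hSA hSB).comp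
      (f := fun i : Module.End.Eigenvalues T × Module.End.Eigenvalues S =>
        ((i.1 : ℂ), (i.2 : ℂ)))
      (fun i j h => by
        simp only [Prod.mk.injEq] at h
        exact Prod.ext (Subtype.ext h.1) (Subtype.ext h.2))
  have hV : DirectSum.IsInternal V := by
    rw [hV'.isInternal_iff, Submodule.orthogonal_eq_bot_iff, eq_top_iff,
      ← LinearMap.IsSymmetric.iSup_iSup_eigenspace_inf_eigenspace_eq_top_of_commute hSA hSB hST]
    refine iSup_le fun s => iSup_le fun t => ?_
    by_cases hs : Module.End.HasEigenvalue S s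
    · by_cases ht : Module.End.HasEigenvalue T t
      · exact le_iSup V (⟨t, ht⟩, ⟨s, hs⟩)
      · rw [Module.End.hasEigenvalue_iff, not_not] at ht
        simp [ht]
    · rw [Module.End.hasEigenvalue_iff, not_not] at hs
      simp [hs]
  let e := hV.subordinateOrthonormalBasis (finrank_euclideanSpace (𝕜 := ℂ) (ι := n)) hV'
  let k := Fintype.equivFin n
  let c : OrthonormalBasis n ℂ (EuclideanSpace ℂ n) := e.reindex k.symm
  let U : Matrix n n ℂ := (EuclideanSpace.basisFun n ℂ).toBasis.toMatrix c
  have hU : U ∈ unitaryGroup n ℂ := OrthonormalBasis.toMatrix_orthonormalBasis_mem_unitary _ _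
  have hUe : ∀ i j, U i j = c j i := fun i j => by
    simp [U, Module.Basis.toMatrix_apply]
  have hc : ∀ j, ∃ s t : ℂ, S (c j) = s • c j ∧ T (c j) = t • c j := fun j => by
    have := hV.subordinateOrthonormalBasis_subordinate
      (finrank_euclideanSpace (𝕜 := ℂ) (ι := n)) (k j) hV'
    have hcj : c j = hV.subordinateOrthonormalBasis
        (finrank_euclideanSpace (𝕜 := ℂ) (ι := n)) hV' (k j) := by simp [c, e]
    rw [← hcj] at this
    exact ⟨_, _, Module.End.mem_eigenspace_iff.mp this.1, Module.End.mem_eigenspace_iff.mp this.2⟩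
  choose s t hs ht using hc
  have key : ∀ (M : Matrix n n ℂ) (hM : M.IsHermitian) (m : n → ℂ),
      (∀ j, toEuclideanLin M (c j) = m j • c j) →
      M = U * diagonal (fun i => (((m i).re : ℝ) : ℂ)) * star U := by
    intro M hM m hm
    have h1 : M * U = U * diagonal m := by
      ext i j
      have := congrArg (fun v : EuclideanSpace ℂ n => v i) (hm j)
      simp only [toLpLin_apply, PiLp.smul_apply, smul_eq_mul, mulVec, dotProduct] at this
      rw [mul_diagonal, mul_apply]
      simp only [hUe]
      rw [this, mul_comm]
    have hUU : star U * U = 1 := (mem_unitaryGroup_iff').mp hU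
    have hUU' : U * star U = 1 := (mem_unitaryGroup_iff).mp hU
    have h2 : diagonal m = star U * M * U := by rw [mul_assoc, h1, ← mul_assoc, hUU, one_mul]
    have h3 : (diagonal m).IsHermitian := by
      rw [h2]
      exact isHermitian_conjTranspose_mul_mul U hM
    have h4 : ∀ i, (((m i).re : ℝ) : ℂ) = m i := fun i => by
      have := congrFun (congrFun h3 i) i
      simp only [conjTranspose_apply, diagonal_apply_eq] at this
      exact Complex.conj_eq_iff_re.mp this
    simp only [h4]
    rw [← h1, mul_assoc, hUU', mul_one]
  exact ⟨U, hU, _, _, key A hA s hs, key B hB t ht⟩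

theorem continuousOn_spectrum_real (A : Matrix n n ℂ) (f : ℝ → ℝ) :
    ContinuousOn f (spectrum ℝ A) :=
  A.finite_real_spectrum.continuousOn f

theorem isHermitian_unitary_conj_diagonal (U : Matrix n n ℂ) (a : n → ℝ) :
    (U * diagonal (fun i => (a i : ℂ)) * star U).IsHermitian :=
  isHermitian_mul_mul_conjTranspose U (isHermitian_diagonal_of_self_adjoint _ (by
    ext i; simp))

theorem cfc_unitary_conj_diagonal {U : Matrix n n ℂ} (hU : U ∈ unitaryGroup n ℂ) (a : n → ℝ)
    (f : ℝ → ℝ) :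
    cfc f (U * diagonal (fun i => (a i : ℂ)) * star U) =
      U * diagonal (fun i => (f (a i) : ℂ)) * star U := by
  set M := U * diagonal (fun i => (a i : ℂ)) * star U with hM
  have hMs : IsSelfAdjoint M := isHermitian_unitary_conj_diagonal U a
  let s : Finset ℝ := M.finite_real_spectrum.toFinset ∪ Finset.univ.image a
  let q : Polynomial ℝ := Lagrange.interpolate s id f
  have hq : ∀ x ∈ s, q.eval x = f x := fun x hx =>
    Lagrange.eval_interpolate_at_node (v := id) f Function.injective_id.injOn hx
  have h1 : cfc f M = cfc q.eval M := cfc_congr fun x hx =>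
    (hq x (Finset.mem_union_left _ (by simpa using hx))).symm
  have h2 : ∀ i, f (a i) = q.eval (a i) := fun i =>
    (hq _ (Finset.mem_union_right _ (by simp))).symm
  let φ : Matrix n n ℂ →ₐ[ℝ] Matrix n n ℂ :=
    ((Unitary.conjStarAlgAut ℂ (Matrix n n ℂ) ⟨U, hU⟩ : _ ≃⋆ₐ[ℂ] _) :
      Matrix n n ℂ →ₐ[ℂ] Matrix n n ℂ).restrictScalars ℝ
  have hφ : ∀ N, φ N = U * N * star U := fun N =>
    Unitary.conjStarAlgAut_apply (S := ℂ) ⟨U, hU⟩ N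
  rw [h1, cfc_polynomial q M hMs, hM, ← hφ, ← hφ, Polynomial.aeval_algHom_apply]
  congr 1
  have h3 : diagonal (fun i => (a i : ℂ)) = diagonalAlgHom ℝ (fun i => (a i : ℂ)) := rfl
  rw [h3, Polynomial.aeval_algHom_apply, diagonalAlgHom_apply]
  congr 1
  ext i
  rw [h2 i, Polynomial.aeval_pi_apply]
  exact Polynomial.aeval_algebraMap_apply ℂ (a i) q

theorem trace_cfc {A : Matrix n n ℂ} (hA : A.IsHermitian) (f : ℝ → ℝ) :
    (cfc f A).trace = ∑ i, (f (hA.eigenvalues i) : ℂ) := by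
  rw [hA.cfc_eq, IsHermitian.cfc, Unitary.conjStarAlgAut_apply, trace_mul_cycle]
  simp [trace_diagonal]

open scoped MatrixOrder Matrix.Norms.L2Operator in
theorem PosSemidef.trace_mul_re_nonneg {A B : Matrix n n ℂ} (hA : A.PosSemidef)
    (hB : B.PosSemidef) : 0 ≤ (A * B).trace.re := by
  obtain ⟨C, rfl⟩ := CStarAlgebra.nonneg_iff_eq_star_mul_self.mp hB.nonneg
  rw [← mul_assoc, trace_mul_cycle]
  exact (Complex.le_def.mp (hA.mul_mul_conjTranspose_same C).trace_nonneg).1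

end SpectralCalculus

end Matrix

/-- Operator antitonicity of `t ↦ t ^ (-p)` for `p ∈ (0, 1]`. -/
theorem CFC.rpow_neg_le_rpow_neg {A : Type*} [CStarAlgebra A] [PartialOrder A] [StarOrderedRing A]
    {p : ℝ} (hp : p ∈ Set.Ioc 0 1) {a b : A} (ha : IsStrictlyPositive a) (hab : a ≤ b) :
    b ^ (-p) ≤ a ^ (-p) := by
  have hb : IsStrictlyPositive b := ha.of_le hab
  rw [← CFC.inverse_rpow a p hp.1.ne' ha, ← CFC.inverse_rpow b p hp.1.ne' hb]
  exact CStarAlgebra.ringInverse_le_ringInverse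
    (CFC.rpow_le_rpow ⟨hp.1.le, hp.2⟩ hab) (IsStrictlyPositive.rpow a p ha)

namespace Matrix

section Powers

variable {n : Type*} [Fintype n] [DecidableEq n]

theorem PosSemidef.nonneg_of_mem_spectrum {A : Matrix n n ℂ} (hA : A.PosSemidef) {x : ℝ}
    (hx : x ∈ spectrum ℝ A) : 0 ≤ x := by
  obtain ⟨i, rfl⟩ := hA.1.spectrum_real_eq_range_eigenvalues ▸ hx
  exact hA.eigenvalues_nonneg i

open scoped MatrixOrder Matrix.Norms.L2Operator in
/-- If `X ≤ ν Y`, then `(Y + ε) ^ (-p) ≤ (X / ν + ε) ^ (-p)` for `p ∈ (0, 1]`. -/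
theorem posSemidef_cfc_rpow_neg_sub {X Y : Matrix n n ℂ} (hX : X.PosSemidef)
    (hY : Y.PosSemidef) {ν ε p : ℝ} (hν : 0 < ν) (hε : 0 < ε) (hp : p ∈ Set.Ioc 0 1)
    (h : (ν • Y - X).PosSemidef) :
    (cfc (fun x : ℝ => (x / ν + ε) ^ (-p)) X - cfc (fun y : ℝ => (y + ε) ^ (-p)) Y).PosSemidef := by
  have hXs : IsSelfAdjoint X := hX.1
  have hYs : IsSelfAdjoint Y := hY.1
  have hXp : ∀ x ∈ spectrum ℝ X, 0 < x / ν + ε := fun x hx => by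
    have := hX.nonneg_of_mem_spectrum hx
    positivity
  have hYp : ∀ y ∈ spectrum ℝ Y, 0 < y + ε := fun y hy => by
    have := hY.nonneg_of_mem_spectrum hy
    positivity
  rw [← CFC.cfc_rpow hXp (X.continuousOn_spectrum_real _) hXs,
    ← CFC.cfc_rpow hYp (Y.continuousOn_spectrum_real _) hYs]
  refine Matrix.le_iff.mp (CFC.rpow_neg_le_rpow_neg hp ?_ ?_)
  · exact (cfc_isStrictlyPositive_iff _ X (X.continuousOn_spectrum_real _) hXs).mpr hXp
  · have e1 : cfc (fun x : ℝ => x / ν + ε) X = ν⁻¹ • X + algebraMap ℝ _ ε := by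
      rw [cfc_add_const ε (fun x : ℝ => x / ν) X (X.continuousOn_spectrum_real _) hXs]
      simp only [div_eq_inv_mul]
      rw [cfc_const_mul_id ν⁻¹ X hXs]
    have e2 : cfc (fun y : ℝ => y + ε) Y = Y + algebraMap ℝ _ ε := by
      rw [cfc_add_const ε (fun y : ℝ => y) Y (Y.continuousOn_spectrum_real _) hYs, cfc_id' ℝ Y hYs]
    rw [e1, e2, Matrix.le_iff]
    have := h.smul (inv_nonneg.mpr hν.le)
    rwa [smul_sub, smul_smul, inv_mul_cancel₀ hν.ne', one_smul,
      ← add_sub_add_right_eq_sub _ _ (algebraMap ℝ (Matrix n n ℂ) ε)] at this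

theorem matPow_eq_cfc (M : Matrix n n ℂ) {r : ℝ} (hr : r ≠ 0) :
    matPow M r = cfc (fun x : ℝ => x ^ r) M := by
  unfold matPow
  split_ifs with h
  · rw [h.cfc_eq, IsHermitian.cfc, Unitary.conjStarAlgAut_apply]
    congr 3
    ext i
    by_cases h0 : h.eigenvalues i = 0
    · simp [rpow0, h0, Real.zero_rpow hr]
    · simp [rpow0, h0]
  · exact (cfc_apply_of_not_predicate M h).symm

theorem posProj_eq_cfc (M : Matrix n n ℂ) :
    posProj M = cfc (fun x : ℝ => if 0 ≤ x then 1 else 0) M := by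
  unfold posProj
  split_ifs with h
  · rw [h.cfc_eq, IsHermitian.cfc, Unitary.conjStarAlgAut_apply]
    congr 3
    ext i
    simp [apply_ite]
  · exact (cfc_apply_of_not_predicate M h).symm

theorem spectralProj_eq_cfc {M : Matrix n n ℂ} (h : M.IsHermitian) (t : ℝ) :
    spectralProj M h t = cfc (fun x : ℝ => if x = t then 1 else 0) M := by
  rw [h.cfc_eq, IsHermitian.cfc, Unitary.conjStarAlgAut_apply, spectralProj]
  congr 3
  ext i
  simp [apply_ite]

theorem posProj_unitary_conj_diagonal {U : Matrix n n ℂ} (hU : U ∈ unitaryGroup n ℂ)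
    (a : n → ℝ) :
    posProj (U * diagonal (fun i => (a i : ℂ)) * star U) =
      U * diagonal (fun i => (((if 0 ≤ a i then 1 else 0 : ℝ)) : ℂ)) * star U := by
  rw [posProj_eq_cfc, cfc_unitary_conj_diagonal hU]

end Powers

section Pinching

variable {n : Type*} [Fintype n] [DecidableEq n] {σ : Matrix n n ℂ}

theorem isHermitian_spectralProj (h : σ.IsHermitian) (t : ℝ) : (spectralProj σ h t).IsHermitian := by
  rw [spectralProj_eq_cfc]
  exact cfc_predicate _ σ

theorem commute_spectralProj (h : σ.IsHermitian) (t : ℝ) {C : Matrix n n ℂ} (hC : Commute σ C) :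
    Commute (spectralProj σ h t) C := by
  rw [spectralProj_eq_cfc]
  exact hC.cfc_real _

theorem spectralProj_mul_self (h : σ.IsHermitian) (t : ℝ) :
    spectralProj σ h t * spectralProj σ h t = spectralProj σ h t := by
  rw [spectralProj_eq_cfc, ← cfc_mul _ _ σ (σ.continuousOn_spectrum_real _)
    (σ.continuousOn_spectrum_real _)]
  simp only [mul_ite, mul_one, mul_zero]
  congr 1
  ext x
  split_ifs <;> rfl

theorem mul_spectralProj (h : σ.IsHermitian) (t : ℝ) :
    σ * spectralProj σ h t = t • spectralProj σ h t := by
  rw [spectralProj_eq_cfc, ← cfc_const_mul _ _ σ (σ.continuousOn_spectrum_real _)]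
  nth_rw 1 [← cfc_id' ℝ σ h.isSelfAdjoint]
  rw [← cfc_mul _ _ σ (σ.continuousOn_spectrum_real _) (σ.continuousOn_spectrum_real _)]
  congr 1
  ext x
  split_ifs with hx <;> simp [hx]

theorem sum_spectralProj (h : σ.IsHermitian) :
    ∑ t ∈ Finset.univ.image h.eigenvalues, spectralProj σ h t = 1 := by
  simp only [spectralProj_eq_cfc]
  rw [← cfc_sum (fun t x : ℝ => if x = t then (1 : ℝ) else 0) σ (Finset.univ.image h.eigenvalues)
    (fun _ _ => σ.continuousOn_spectrum_real _), ← cfc_const_one ℝ σ h]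
  refine cfc_congr fun x hx => ?_
  obtain ⟨i, rfl⟩ := h.spectrum_real_eq_range_eigenvalues ▸ hx
  simp [Finset.sum_apply]

theorem pinch_eq (h : σ.IsHermitian) (X : Matrix n n ℂ) :
    pinch σ X = ∑ t ∈ Finset.univ.image h.eigenvalues,
      spectralProj σ h t * X * spectralProj σ h t := dif_pos h

theorem commute_pinch (h : σ.IsHermitian) (X : Matrix n n ℂ) : Commute σ (pinch σ X) := by
  rw [pinch_eq h]
  refine Commute.sum_right _ _ _ fun t _ => ?_
  have hc : spectralProj σ h t * σ = t • spectralProj σ h t := by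
    rw [← mul_spectralProj, (commute_spectralProj h t (Commute.refl σ)).eq]
  rw [commute_iff_eq, mul_assoc _ _ σ, hc, ← mul_assoc, ← mul_assoc, mul_spectralProj]
  simp

theorem PosSemidef.pinch (h : σ.IsHermitian) {X : Matrix n n ℂ} (hX : X.PosSemidef) :
    (pinch σ X).PosSemidef := by
  rw [pinch_eq h]
  refine posSemidef_sum _ fun t _ => ?_
  have := hX.conjTranspose_mul_mul_same (spectralProj σ h t)
  rwa [(isHermitian_spectralProj h t).eq] at this

theorem trace_mul_pinch (h : σ.IsHermitian) {C : Matrix n n ℂ} (hC : Commute σ C)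
    (X : Matrix n n ℂ) : (C * _root_.pinch σ X).trace = (C * X).trace := by
  rw [pinch_eq h, Finset.mul_sum, trace_sum]
  calc _ = ∑ t ∈ Finset.univ.image h.eigenvalues, (spectralProj σ h t * (C * X)).trace := by
        refine Finset.sum_congr rfl fun t _ => ?_
        rw [← mul_assoc, trace_mul_comm, ← mul_assoc, ← mul_assoc,
          (commute_spectralProj h t hC).eq, mul_assoc C, spectralProj_mul_self,
          ← (commute_spectralProj h t hC).eq, mul_assoc]
    _ = _ := by rw [← trace_sum, ← Finset.sum_mul, sum_spectralProj, one_mul]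

theorem mul_pinch_mul (h : σ.IsHermitian) {C : Matrix n n ℂ} (hC : Commute σ C)
    (X : Matrix n n ℂ) : C * _root_.pinch σ X * C = _root_.pinch σ (C * X * C) := by
  rw [pinch_eq h, pinch_eq h, Finset.mul_sum, Finset.sum_mul]
  refine Finset.sum_congr rfl fun t _ => ?_
  have hc := (commute_spectralProj h t hC).eq
  calc _ = C * spectralProj σ h t * X * (spectralProj σ h t * C) := by simp only [mul_assoc]
    _ = spectralProj σ h t * C * X * (C * spectralProj σ h t) := by rw [hc]
    _ = _ := by simp only [mul_assoc]

/-- The pinching inequality `X ≤ ν_σ • ℰ_σ(X)`. -/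
theorem posSemidef_nEig_smul_pinch_sub (h : σ.IsHermitian) {X : Matrix n n ℂ}
    (hX : X.PosSemidef) : (((nEig σ : ℕ) : ℝ) • _root_.pinch σ X - X).PosSemidef := by
  set s := Finset.univ.image h.eigenvalues with hs
  set P := spectralProj σ h with hP
  have hν : nEig σ = s.card := dif_pos h
  have key : ((2 : ℝ)⁻¹) • ∑ i ∈ s, ∑ j ∈ s, (P i - P j) * X * (P i - P j) =
      ((nEig σ : ℕ) : ℝ) • _root_.pinch σ X - X := by
    have e : ∀ i j, (P i - P j) * X * (P i - P j) =
        P i * X * P i + P j * X * P j - (P i * X * P j + P j * X * P i) := fun i j => by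
      noncomm_ring
    have hone : ∑ i ∈ s, P i = 1 := sum_spectralProj h
    have e2 : ∑ i ∈ s, ∑ j ∈ s, P i * X * P j = X := by
      simp only [← Finset.mul_sum, hone, mul_one, ← Finset.sum_mul, one_mul]
    have e3 : ∑ i ∈ s, ∑ j ∈ s, P j * X * P i = X := by rw [Finset.sum_comm, e2]
    simp only [e, Finset.sum_sub_distrib, Finset.sum_add_distrib, e2, e3, Finset.sum_const,
      ← Finset.smul_sum]
    rw [hν, pinch_eq h, ← two_nsmul, ← two_nsmul, ← nsmul_sub, ← Nat.cast_smul_eq_nsmul ℝ 2,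
      smul_smul, ← Nat.cast_smul_eq_nsmul ℝ s.card]
    norm_num
    rfl
  rw [← key]
  refine PosSemidef.smul (posSemidef_sum _ fun i _ => posSemidef_sum _ fun j _ => ?_) (by norm_num)
  have := hX.conjTranspose_mul_mul_same (P i - P j)
  rwa [((isHermitian_spectralProj h i).sub (isHermitian_spectralProj h j)).eq] at this

end Pinching

end Matrix

namespace Matrix

section Traces

variable {n : Type*} [Fintype n] [DecidableEq n]

theorem nEig_pos [Nonempty n] {σ : Matrix n n ℂ} (h : σ.IsHermitian) : 0 < nEig σ := by
  rw [nEig, dif_pos h]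
  exact Finset.card_pos.mpr (Finset.univ_nonempty.image _)

theorem trace_cfc_mul_self {A : Matrix n n ℂ} (hA : A.IsHermitian) (f : ℝ → ℝ) :
    (cfc f A * A).trace.re = ∑ i, f (hA.eigenvalues i) * hA.eigenvalues i := by
  have h : cfc f A * A = cfc (fun x => f x * x) A := by
    rw [cfc_mul _ _ A (A.continuousOn_spectrum_real _) (A.continuousOn_spectrum_real _),
      cfc_id' ℝ A hA.isSelfAdjoint]
  rw [h, trace_cfc hA, ← Complex.ofReal_sum, Complex.ofReal_re]

/-- Regularized form of the bound `Tr[Y ^ (1 - p)] ≤ ν ^ p Tr[X ^ (1 - p)]` for the pinching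
`Y = ℰ_σ(X)`. -/
theorem sum_eigenvalues_pinch_le {σ X : Matrix n n ℂ} (h : σ.IsHermitian) (hX : X.PosSemidef)
    (hY : (pinch σ X).PosSemidef) {p ε : ℝ} (hp : p ∈ Set.Ioc 0 1) (hν : 0 < (nEig σ : ℝ))
    (hε : 0 < ε) :
    ∑ i, (hY.1.eigenvalues i + ε) ^ (-p) * hY.1.eigenvalues i ≤
      (nEig σ : ℝ) ^ p * ∑ i, hX.1.eigenvalues i ^ (1 - p) := by
  set ν : ℝ := (nEig σ : ℝ)
  set Y := pinch σ X with hYdef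
  have hC : Commute σ (cfc (fun y : ℝ => (y + ε) ^ (-p)) Y) :=
    ((commute_pinch h X).symm.cfc_real _).symm
  have hle := (posSemidef_cfc_rpow_neg_sub hX hY hν hε hp
    (posSemidef_nEig_smul_pinch_sub h hX)).trace_mul_re_nonneg hX
  rw [sub_mul, trace_sub, Complex.sub_re, sub_nonneg, ← trace_mul_pinch h hC, ← hYdef,
    trace_cfc_mul_self hX.1, trace_cfc_mul_self hY.1] at hle
  refine hle.trans ?_
  rw [Finset.mul_sum]
  refine Finset.sum_le_sum fun i _ => ?_
  rcases (hX.eigenvalues_nonneg i).eq_or_lt with h0 | h0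
  · rw [← h0, mul_zero]
    positivity
  · set x := hX.1.eigenvalues i
    calc (x / ν + ε) ^ (-p) * x ≤ (x / ν) ^ (-p) * x := by
          refine mul_le_mul_of_nonneg_right ?_ h0.le
          exact Real.rpow_le_rpow_of_nonpos (by positivity) (by linarith) (by linarith [hp.1])
      _ = ν ^ p * x ^ (1 - p) := by
          rw [Real.div_rpow h0.le hν.le, Real.rpow_neg hν.le, div_inv_eq_mul, sub_eq_neg_add,
            Real.rpow_add h0, Real.rpow_one]
          ring

theorem trace_cfc_rpow_pinch_le [Nonempty n] {σ X : Matrix n n ℂ} (h : σ.IsHermitian)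
    (hX : X.PosSemidef) {p : ℝ} (hp : p ∈ Set.Ioo 0 1) :
    (cfc (fun x : ℝ => x ^ (1 - p)) (pinch σ X)).trace.re ≤
      (nEig σ : ℝ) ^ p * (cfc (fun x : ℝ => x ^ (1 - p)) X).trace.re := by
  have hY : (pinch σ X).PosSemidef := hX.pinch h
  rw [trace_cfc hY.1, trace_cfc hX.1, ← Complex.ofReal_sum, ← Complex.ofReal_sum,
    Complex.ofReal_re, Complex.ofReal_re]
  have hlim : Filter.Tendsto
      (fun ε : ℝ => ∑ i, (hY.1.eigenvalues i + ε) ^ (-p) * hY.1.eigenvalues i)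
      (nhdsWithin 0 (Set.Ioi 0)) (nhds (∑ i, hY.1.eigenvalues i ^ (1 - p))) := by
    refine tendsto_finsetSum _ fun i _ => ?_
    rcases (hY.eigenvalues_nonneg i).eq_or_lt with h0 | h0
    · simp only [← h0, mul_zero, Real.zero_rpow (sub_pos.mpr hp.2).ne']
      exact tendsto_const_nhds
    · have hc : ContinuousAt
          (fun ε : ℝ => (hY.1.eigenvalues i + ε) ^ (-p) * hY.1.eigenvalues i) 0 := by
        refine ((continuousAt_const.add continuousAt_id).rpow_const ?_).mul continuousAt_const
        left
        simpa using h0.ne'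
      have := hc.tendsto.mono_left (nhdsWithin_le_nhds (s := Set.Ioi 0))
      rwa [add_zero, mul_comm, ← Real.rpow_one_add' h0.le (by linarith [hp.2]),
        ← sub_eq_add_neg] at this
  refine le_of_tendsto hlim ?_
  filter_upwards [self_mem_nhdsWithin] with ε hε
  exact sum_eigenvalues_pinch_le h hX hY ⟨hp.1, hp.2.le⟩ (by exact_mod_cast nEig_pos h) hε

theorem PosSemidef.nonneg_of_unitary_conj_diagonal {U : Matrix n n ℂ}
    (hU : U ∈ unitaryGroup n ℂ) {a : n → ℝ}
    (h : (U * diagonal (fun i => (a i : ℂ)) * star U).PosSemidef) (i : n) : 0 ≤ a i := by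
  have hUU : star U * U = 1 := mem_unitaryGroup_iff'.mp hU
  have h1 := h.conjTranspose_mul_mul_same U
  rw [← star_eq_conjTranspose, ← mul_assoc, ← mul_assoc, hUU, one_mul, mul_assoc, hUU,
    mul_one] at h1
  simpa using h1.diag_nonneg (i := i)

theorem le_rpow_mul_sandwich_rpow {p s c α : ℝ} (hp : 0 ≤ p) (hs : 0 ≤ s) (hc : 0 ≤ c)
    (hα : α ∈ Set.Ioo 0 1) (h : p ≤ c * s) :
    p ≤ c ^ α * (s ^ (α / (2 * (1 - α))) * p * s ^ (α / (2 * (1 - α)))) ^ (1 - α) := by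
  have h1 : 0 < 1 - α := sub_pos.mpr hα.2
  have hsα : (s ^ (α / (2 * (1 - α)))) ^ (1 - α) * (s ^ (α / (2 * (1 - α)))) ^ (1 - α) =
      s ^ α := by
    rw [← Real.rpow_mul hs]
    have : α / (2 * (1 - α)) * (1 - α) = α / 2 := by field_simp
    rw [this, ← Real.rpow_add_of_nonneg hs (by linarith [hα.1]) (by linarith [hα.1]), add_halves]
  calc p = p ^ α * p ^ (1 - α) := by
        rw [← Real.rpow_add_of_nonneg hp hα.1.le h1.le, add_sub_cancel, Real.rpow_one]
    _ ≤ (c * s) ^ α * p ^ (1 - α) := by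
        gcongr
        exact hα.1.le
    _ = _ := by
        rw [Real.mul_rpow hc hs, Real.mul_rpow (by positivity) (by positivity),
          Real.mul_rpow (by positivity) hp, ← hsα]
        ring

/-- An Audenaert-type bound for commuting positive semidefinite matrices. -/
theorem trace_one_sub_posProj_mul_le {P σ : Matrix n n ℂ} (hP : P.PosSemidef)
    (hσ : σ.PosSemidef) (hc : Commute P σ) {c α : ℝ} (hc0 : 0 ≤ c) (hα : α ∈ Set.Ioo 0 1) :
    ((1 - posProj (P - (c : ℂ) • σ)) * P).trace.re ≤
      c ^ α * (cfc (fun x : ℝ => x ^ (1 - α)) (cfc (fun x : ℝ => x ^ (α / (2 * (1 - α)))) σ * P *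
        cfc (fun x : ℝ => x ^ (α / (2 * (1 - α)))) σ)).trace.re := by
  obtain ⟨U, hU, p, s, rfl, rfl⟩ := hP.1.exists_unitary_diagonal_of_commute hσ.1 hc
  have hp := fun i => hP.nonneg_of_unitary_conj_diagonal hU i
  have hs := fun i => hσ.nonneg_of_unitary_conj_diagonal hU i
  have hUU : star U * U = 1 := mem_unitaryGroup_iff'.mp hU
  have hUU' : U * star U = 1 := mem_unitaryGroup_iff.mp hU
  have hmul : ∀ a b : n → ℂ, U * diagonal a * star U * (U * diagonal b * star U) =
      U * diagonal (fun i => a i * b i) * star U := fun a b => by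
    rw [← diagonal_mul_diagonal]
    calc _ = U * diagonal a * (star U * U) * diagonal b * star U := by simp only [mul_assoc]
      _ = _ := by rw [hUU, mul_one]; simp only [mul_assoc]
  have htr : ∀ a : n → ℝ, (U * diagonal (fun i => (a i : ℂ)) * star U).trace.re = ∑ i, a i :=
    fun a => by
      rw [trace_mul_cycle, hUU, one_mul, trace_diagonal, ← Complex.ofReal_sum, Complex.ofReal_re]
  have hsub : U * diagonal (fun i => (p i : ℂ)) * star U -
      (c : ℂ) • (U * diagonal (fun i => (s i : ℂ)) * star U) =
      U * diagonal (fun i => ((p i - c * s i : ℝ) : ℂ)) * star U := by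
    rw [← Matrix.smul_mul, ← Matrix.mul_smul, ← sub_mul, ← mul_sub, ← diagonal_smul, diagonal_sub]
    simp
  have hone : (1 : Matrix n n ℂ) = U * diagonal (fun _ => 1) * star U := by
    rw [diagonal_one, mul_one, hUU']
  rw [hsub, posProj_unitary_conj_diagonal hU, cfc_unitary_conj_diagonal hU, hmul, hmul, hone,
    ← sub_mul, ← mul_sub, diagonal_sub, hmul]
  simp only [← Complex.ofReal_mul, ← Complex.ofReal_one, ← Complex.ofReal_sub]
  rw [cfc_unitary_conj_diagonal hU, htr, htr, Finset.mul_sum]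
  refine Finset.sum_le_sum fun i _ => ?_
  have hpi := hp i
  have hsi := hs i
  split_ifs with hi
  · rw [sub_self, zero_mul]
    positivity
  · rw [sub_zero, one_mul]
    exact le_rpow_mul_sandwich_rpow hpi hsi hc0 hα (by linarith)

/-- For `Π` the projection onto the nonnegative part of `ℰ_σ(ρ) - c σ`, the trace of `(1 - Π) ρ`
is bounded by the sandwiched quasi-entropy of order `1 - α`. -/
theorem trace_one_sub_posProj_pinch_mul_le [Nonempty n] {ρ σ : Matrix n n ℂ} (hρ : ρ.PosSemidef)
    (hσ : σ.PosSemidef) {c α : ℝ} (hc : 0 ≤ c) (hα : α ∈ Set.Ioo 0 1) :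
    ((1 - posProj (pinch σ ρ - (c : ℂ) • σ)) * ρ).trace.re ≤
      (nEig σ : ℝ) ^ α * c ^ α *
        (matPow (matPow σ (α / (2 * (1 - α))) * ρ *
          matPow σ (α / (2 * (1 - α)))) (1 - α)).trace.re := by
  have h1 : 0 < 1 - α := sub_pos.mpr hα.2
  have hγ : 0 < α / (2 * (1 - α)) := div_pos hα.1 (by positivity)
  have hcomm := commute_pinch hσ.1 ρ
  have hC : Commute σ (1 - posProj (pinch σ ρ - (c : ℂ) • σ)) := by
    refine (Commute.one_right σ).sub_right ?_
    rw [posProj_eq_cfc]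
    exact (((hcomm.sub_right ((Commute.refl σ).smul_right _)).symm).cfc_real _).symm
  rw [← trace_mul_pinch hσ.1 hC, matPow_eq_cfc _ hγ.ne', matPow_eq_cfc _ h1.ne']
  set S := cfc (fun x : ℝ => x ^ (α / (2 * (1 - α)))) σ with hS
  have hSσ : Commute σ S := ((Commute.refl σ).cfc_real _).symm
  have hSh : S.IsHermitian := cfc_predicate _ σ
  have hX : (S * ρ * S).PosSemidef := by
    have := hρ.conjTranspose_mul_mul_same S
    rwa [hSh.eq] at this
  refine (trace_one_sub_posProj_mul_le (hρ.pinch hσ.1) hσ hcomm.symm hc hα).trans ?_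
  rw [← hS, mul_pinch_mul hσ.1 hSσ, mul_comm (_ ^ α) (c ^ α), mul_assoc (c ^ α)]
  exact mul_le_mul_of_nonneg_left (trace_cfc_rpow_pinch_le hσ.1 hX hα) (Real.rpow_nonneg hc _)

end Traces

section Marginals

variable {m n : Type*}

theorem PosSemidef.sum_submatrix_prodMk_left [Fintype n] {ρ : Matrix (m × n) (m × n) ℂ}
    (h : ρ.PosSemidef) : (of fun a a' => ∑ b, ρ (a, b) (a', b) : Matrix m m ℂ).PosSemidef := by
  have : (of fun a a' => ∑ b, ρ (a, b) (a', b) : Matrix m m ℂ) =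
      ∑ b, ρ.submatrix (fun a => (a, b)) (fun a => (a, b)) := by
    ext a a'
    simp [sum_apply]
  rw [this]
  exact posSemidef_sum _ fun b _ => h.submatrix _

theorem PosSemidef.sum_submatrix_prodMk_right [Fintype m] {ρ : Matrix (m × n) (m × n) ℂ}
    (h : ρ.PosSemidef) : (of fun b b' => ∑ a, ρ (a, b) (a, b') : Matrix n n ℂ).PosSemidef := by
  have : (of fun b b' => ∑ a, ρ (a, b) (a, b') : Matrix n n ℂ) =
      ∑ a, ρ.submatrix (Prod.mk a) (Prod.mk a) := by
    ext b b'
    simp [sum_apply]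
  rw [this]
  exact posSemidef_sum _ fun a _ => h.submatrix _

end Marginals

end Matrix

/-- first projector property (Lemma 2, eq. (34)):
`Tr[(I − Π) ρ] ≤ ν₁^α · 2^{α[R + R_S − D̃_{1−α}(ρ‖σ)]}` where `σ = ρ₁ ⊗ ρ₂` and
`Π` is the projection onto the nonnegative part of `ℰ_σ(ρ) − 2^{R+R_S} σ`. -/
theorem projector_property_one
    {ι₁ ι₂ : Type*} [Fintype ι₁] [DecidableEq ι₁] [Nonempty ι₁]
    [Fintype ι₂] [DecidableEq ι₂] [Nonempty ι₂]
    (ρ : Matrix (ι₁ × ι₂) (ι₁ × ι₂) ℂ) (hρ : IsDensityMatrix ρ)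
    (ρ₁ : Matrix ι₁ ι₁ ℂ) (hρ₁ : ∀ a a', ρ₁ a a' = ∑ b : ι₂, ρ (a, b) (a', b))
    (ρ₂ : Matrix ι₂ ι₂ ℂ) (hρ₂ : ∀ b b', ρ₂ b b' = ∑ a : ι₁, ρ (a, b) (a, b'))
    (σ : Matrix (ι₁ × ι₂) (ι₁ × ι₂) ℂ) (hσ : σ = ρ₁ ⊗ₖ ρ₂)
    (R RS α : ℝ) (hR : 0 < R) (hRS : 0 < RS) (hα : α ∈ Set.Ioo (0 : ℝ) (1/2))
    (Proj : Matrix (ι₁ × ι₂) (ι₁ × ι₂) ℂ)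
    (hProj : Proj = posProj (pinch σ ρ - (((2 : ℝ) ^ (R + RS) : ℝ) : ℂ) • σ)) :
    ((1 - Proj) * ρ).trace.re ≤
      (nEig σ : ℝ) ^ α * (2 : ℝ) ^ (α * (R + RS)) *
        (matPow (matPow σ (α / (2 * (1 - α))) * ρ *
          matPow σ (α / (2 * (1 - α)))) (1 - α)).trace.re := by
  have hρ₁' : ρ₁.PosSemidef := by
    have := hρ.1.sum_submatrix_prodMk_left
    simp only [← hρ₁] at this
    exact this
  have hρ₂' : ρ₂.PosSemidef := by
    have := hρ.1.sum_submatrix_prodMk_right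
    simp only [← hρ₂] at this
    exact this
  have hσ' : σ.PosSemidef := by
    rw [hσ]
    exact hρ₁'.kronecker hρ₂'
  rw [hProj, mul_comm α, Real.rpow_mul zero_le_two]
  exact trace_one_sub_posProj_pinch_mul_le hρ.1 hσ' (Real.rpow_nonneg zero_le_two _)
    ⟨hα.1, by linarith [hα.2]⟩
end

section
/- Let 𝒱 and 𝒰 be nonempty finite sets, p : 𝒱×𝒰 → ℝ a probability mass function whose marginal p_U(u) = ∑_{v} p(v,u) is strictly positive for every u, and set p_{V|U}(v|u) := p(v,u)/p_U(u). Let {ρ^{v,u}} be density matrices on ℂ^d, and let σ^u := ∑_{v} p_{V|U}(v|u) ρ^{v,u}; assume each σ^u is positive definite. Fix α ∈ (0, 1/2), an integer L ≥ 1, and let ν₂ := max_{u} (number of distinct eigenvalues of σ^u). For u ∈ 𝒰 and v = (v_1,…,v_L) ∈ 𝒱^L, set τ_{u,v} := (1/L) ∑_{ℓ=1}^L ρ^{v_ℓ,u}. Then ∑_{u∈𝒰} p_U(u) ∑_{v∈𝒱^L} (∏_{ℓ=1}^L p_{V|U}(v_ℓ|u)) · 2^{α D̃_{1+α}(τ_{u,v}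 ‖ σ^u)} ≤ 1 + (ν₂^α / L^α) · K, where K := ∑_{(v,u)∈𝒱×𝒰} p(v,u) · Tr[((σ^u)^{−α/(2(1+α))} ρ^{v,u} (σ^u)^{−α/(2(1+α))})^{1+α}]. -/
open Matrix BigOperators
open scoped ComplexOrder

section

open scoped MatrixOrder Matrix.Norms.L2Operator

theorem CFC.smul_add_rpow_le_of_commute {A : Type*} [CStarAlgebra A] [PartialOrder A]
    [StarOrderedRing A] {a b : A} (ha : 0 ≤ a) (hb : 0 ≤ b) (hab : Commute a b)
    {c p : ℝ} (hc : 0 ≤ c) (hp : p ∈ Set.Ioc (0 : ℝ) 1) :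
    (c • a + b) ^ p ≤ c ^ p • a ^ p + b ^ p := by
  obtain ⟨z, hz⟩ : ∃ z : A, z = a + Complex.I • b := ⟨_, rfl⟩
  have hsa : star a = a := (IsSelfAdjoint.of_nonneg ha).star_eq
  have hsb : star b = b := (IsSelfAdjoint.of_nonneg hb).star_eq
  have hstar : star z = a - Complex.I • b := by
    simp [hz, hsa, hsb, sub_eq_add_neg]
  have hn : IsStarNormal z := by
    refine ⟨?_⟩
    rw [hstar, hz]
    have h1 : Commute a (Complex.I • b) := hab.smul_right _
    exact (((Commute.refl a).add_right h1).sub_left (h1.symm.add_right (Commute.refl _)))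
  have hcre : Continuous fun w : ℂ => (w.re : ℂ) := by fun_prop
  have hcim : Continuous fun w : ℂ => (w.im : ℂ) := by fun_prop
  have hcp : Continuous fun t : ℝ => t ^ p := Real.continuous_rpow_const hp.1.le
  have hre : a = cfc (fun w : ℂ => (w.re : ℂ)) z := by
    have : (fun w : ℂ => (w.re : ℂ)) = fun w : ℂ => (1 / 2 : ℂ) • (w + star w) := by
      ext w; exact Complex.ext (by simp; ring) (by simp)
    rw [this, cfc_smul (1 / 2 : ℂ) (fun w : ℂ => w + star w) z (by fun_prop),
      cfc_add z (fun w : ℂ => w) (fun w : ℂ => star w) (by fun_prop) (by fun_prop),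
      cfc_id' ℂ z hn, cfc_star_id (R := ℂ) (a := z) hn, hstar, hz,
      add_add_sub_cancel, ← two_smul ℂ a, smul_smul]
    simp
  have him : b = cfc (fun w : ℂ => (w.im : ℂ)) z := by
    have : (fun w : ℂ => (w.im : ℂ)) = fun w : ℂ => (-Complex.I / 2 : ℂ) • (w - star w) := by
      ext w; exact Complex.ext (by simp; ring) (by simp)
    rw [this, cfc_smul (-Complex.I / 2 : ℂ) (fun w : ℂ => w - star w) z (by fun_prop),
      cfc_sub (fun w : ℂ => w) (fun w : ℂ => star w) z (by fun_prop) (by fun_prop),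
      cfc_id' ℂ z hn, cfc_star_id (R := ℂ) (a := z) hn, hstar, hz,
      add_sub_sub_cancel, ← two_smul ℂ (Complex.I • b), smul_smul, smul_smul]
    ring_nf
    simp
  have hpow (f : ℂ → ℝ) (hf : Continuous f) (x : A) (hx : 0 ≤ x)
      (hxf : x = cfc (fun w : ℂ => (f w : ℂ)) z) :
      x ^ p = cfc (fun w : ℂ => ((f w ^ p : ℝ) : ℂ)) z := by
    rw [CFC.rpow_eq_cfc_real hx, cfc_real_eq_complex _ (IsSelfAdjoint.of_nonneg hx), hxf,
      ← cfc_comp' (fun w : ℂ => ((w.re ^ p : ℝ) : ℂ)) (fun w : ℂ => (f w : ℂ)) z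
        (by fun_prop) (by fun_prop) hn]
    simp
  have hsum : c • a + b = cfc (fun w : ℂ => ((c * w.re + w.im : ℝ) : ℂ)) z := by
    have : (fun w : ℂ => ((c * w.re + w.im : ℝ) : ℂ)) =
        fun w : ℂ => (c • (w.re : ℂ)) + (w.im : ℂ) := by
      ext w; simp
    rw [this, cfc_add z (fun w : ℂ => c • (w.re : ℂ)) (fun w : ℂ => (w.im : ℂ))
      (by fun_prop) (by fun_prop), cfc_smul c (fun w : ℂ => (w.re : ℂ)) z (by fun_prop),
      ← hre, ← him]
  have hspec (f : ℂ → ℝ) (hf : Continuous f) (x : A) (hx : 0 ≤ x)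
      (hxf : x = cfc (fun w : ℂ => (f w : ℂ)) z) (w : ℂ) (hw : w ∈ spectrum ℂ z) : 0 ≤ f w := by
    have hmem : (f w : ℂ) ∈ spectrum ℂ x := by
      rw [hxf, cfc_map_spectrum (fun w : ℂ => (f w : ℂ)) z hn (by fun_prop)]
      exact ⟨w, hw, rfl⟩
    exact_mod_cast spectrum_nonneg_of_nonneg hx hmem
  have hcrep : Continuous fun w : ℂ => ((w.re ^ p : ℝ) : ℂ) := by fun_prop
  have hcres : Continuous fun w : ℂ => c ^ p • ((w.re ^ p : ℝ) : ℂ) := hcrep.const_smul (c ^ p)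
  have hcimp : Continuous fun w : ℂ => ((w.im ^ p : ℝ) : ℂ) := by fun_prop
  have hcsum : Continuous fun w : ℂ => (((c * w.re + w.im) ^ p : ℝ) : ℂ) := by fun_prop
  rw [hpow _ (by fun_prop) _ (add_nonneg (smul_nonneg hc ha) hb) hsum,
    hpow _ Complex.continuous_re a ha hre, hpow _ Complex.continuous_im b hb him,
    ← cfc_smul (c ^ p : ℝ) (fun w : ℂ => ((w.re ^ p : ℝ) : ℂ)) z hcrep.continuousOn,
    ← cfc_add z _ _ hcres.continuousOn hcimp.continuousOn]
  refine cfc_mono (fun w hw => ?_) hcsum.continuousOn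
    (hcres.add hcimp).continuousOn
  have h1 := hspec _ Complex.continuous_re a ha hre w hw
  have h2 := hspec _ Complex.continuous_im b hb him w hw
  have := Real.rpow_add_le_add_rpow (mul_nonneg hc h1) h2 hp.1.le hp.2
  rw [Real.mul_rpow hc h1] at this
  rw [Complex.real_smul]
  exact_mod_cast this

theorem CFC.mul_rpow_self {A : Type*} [CStarAlgebra A] [PartialOrder A] [StarOrderedRing A]
    {a : A} (ha : 0 ≤ a) {p : ℝ} (hp : 0 < p) : a * a ^ p = a ^ (1 + p) := by
  lift p to NNReal using hp.le
  have hp' : 0 < p := hp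
  have h : (1 + p : ℝ) = ((1 + p : NNReal) : ℝ) := by simp
  rw [h, ← CFC.nnrpow_eq_rpow hp', ← CFC.nnrpow_eq_rpow (by positivity),
    CFC.nnrpow_add one_pos hp', CFC.nnrpow_one a ha]

namespace Matrix

variable {n : Type*} [Fintype n]

theorem re_trace_nonneg {A : Matrix n n ℂ} (hA : 0 ≤ A) : 0 ≤ A.trace.re :=
  (Complex.le_def.1 (nonneg_iff_posSemidef.1 hA).trace_nonneg).1

theorem conj_nonneg_of_nonneg {S A : Matrix n n ℂ} (hS : 0 ≤ S) (hA : 0 ≤ A) : 0 ≤ S * A * S := by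
  have := star_left_conjugate_nonneg hA S
  rwa [(IsSelfAdjoint.of_nonneg hS).star_eq] at this

theorem sum_conj_nonneg {ι : Type*} [Fintype ι] {P : ι → Matrix n n ℂ}
    (hP : ∀ i, star (P i) = P i) {X : Matrix n n ℂ} (hX : 0 ≤ X) :
    0 ≤ ∑ i, P i * X * P i :=
  Finset.sum_nonneg fun i _ => by
    have := star_left_conjugate_nonneg hX (P i)
    rwa [hP] at this

variable [DecidableEq n]

theorem re_trace_mul_le_re_trace_mul {X A B : Matrix n n ℂ} (hX : 0 ≤ X) (h : A ≤ B) :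
    (X * A).trace.re ≤ (X * B).trace.re := by
  have hs : star (CFC.sqrt X) = CFC.sqrt X :=
    (IsSelfAdjoint.of_nonneg (CFC.sqrt_nonneg X)).star_eq
  have h0 : 0 ≤ CFC.sqrt X * (B - A) * CFC.sqrt X := by
    have := star_left_conjugate_nonneg (sub_nonneg.2 h) (CFC.sqrt X)
    rwa [hs] at this
  have h1 := (nonneg_iff_posSemidef.1 h0).trace_nonneg
  rw [trace_mul_comm, ← mul_assoc, CFC.sqrt_mul_sqrt_self X hX, mul_sub, trace_sub] at h1
  have := (Complex.le_def.1 h1).1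
  simpa using this

theorem IsHermitian.cfc_eq_mul_diagonal_mul_star {A : Matrix n n ℂ} (hA : A.IsHermitian)
    (f : ℝ → ℝ) : cfc f A = (hA.eigenvectorUnitary : Matrix n n ℂ) *
      diagonal (fun i => (f (hA.eigenvalues i) : ℂ)) *
      star (hA.eigenvectorUnitary : Matrix n n ℂ) := by
  rw [hA.cfc_eq]
  rfl

theorem exists_re_trace_cfc_mul_cfc {A B : Matrix n n ℂ} (hA : A.IsHermitian)
    (hB : B.IsHermitian) : ∃ w : n → n → ℝ, (∀ i j, 0 ≤ w i j) ∧ ∀ f g : ℝ → ℝ,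
      (cfc f A * cfc g B).trace.re =
        ∑ i, ∑ j, w i j * (f (hA.eigenvalues i) * g (hB.eigenvalues j)) := by
  set S : Matrix n n ℂ := (hA.eigenvectorUnitary : Matrix n n ℂ)
  set T : Matrix n n ℂ := (hB.eigenvectorUnitary : Matrix n n ℂ)
  refine ⟨fun i j => Complex.normSq ((star S * T) i j), fun i j => Complex.normSq_nonneg _,
    fun f g => ?_⟩
  have h1 : cfc f A = S * diagonal (fun i => (f (hA.eigenvalues i) : ℂ)) * star S :=
    hA.cfc_eq_mul_diagonal_mul_star f
  have h2 : cfc g B = T * diagonal (fun i => (g (hB.eigenvalues i) : ℂ)) * star T :=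
    hB.cfc_eq_mul_diagonal_mul_star g
  have h3 : (cfc f A * cfc g B).trace =
      (diagonal (fun i => (f (hA.eigenvalues i) : ℂ)) * (star S * T) *
        (diagonal (fun i => (g (hB.eigenvalues i) : ℂ)) * star (star S * T))).trace := by
    rw [h1, h2, star_mul, star_star, mul_assoc, mul_assoc, trace_mul_comm]
    simp only [mul_assoc]
  rw [h3, trace]
  simp only [diag_apply, mul_apply (M := _ * (star S * T)), diagonal_mul, Complex.re_sum,
    star_apply]
  refine Finset.sum_congr rfl fun i _ => Finset.sum_congr rfl fun j _ => ?_
  have h4 (x y : ℝ) (z : ℂ) : ((x : ℂ) * z * (y * star z)).re = Complex.normSq z * (x * y) := by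
    simp [Complex.normSq_apply]; ring
  exact h4 _ _ _

theorem re_trace_mul_rpow_le {A B : Matrix n n ℂ} (hA : 0 ≤ A) (hB : 0 ≤ B) {p : ℝ}
    (hp : 0 < p) : (1 + p) * (A * B ^ p).trace.re ≤
      (A ^ (1 + p)).trace.re + p * (B ^ (1 + p)).trace.re := by
  have hA' := nonneg_iff_posSemidef.1 hA
  have hB' := nonneg_iff_posSemidef.1 hB
  obtain ⟨w, hw, h⟩ := exists_re_trace_cfc_mul_cfc hA'.isHermitian hB'.isHermitian
  have e1 := h (fun x => x) (fun x => x ^ p)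
  have e2 := h (fun x => x ^ (1 + p)) (fun _ => 1)
  have e3 := h (fun _ => 1) (fun x => x ^ (1 + p))
  have hid : cfc (fun x : ℝ => x) A = A := cfc_id' ℝ A hA'.isHermitian
  have hone (C : Matrix n n ℂ) (hC : C.IsHermitian) : cfc (fun _ : ℝ => (1 : ℝ)) C = 1 :=
    cfc_const_one ℝ C hC
  have hpow (C : Matrix n n ℂ) (hC : 0 ≤ C) (r : ℝ) : cfc (fun x : ℝ => x ^ r) C = C ^ r :=
    (CFC.rpow_eq_cfc_real hC).symm
  rw [hid, hpow B hB] at e1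
  rw [hone B hB'.isHermitian, hpow A hA, mul_one] at e2
  rw [hone A hA'.isHermitian, hpow B hB, one_mul] at e3
  rw [e1, e2, e3]
  simp only [Finset.mul_sum, ← Finset.sum_add_distrib]
  refine Finset.sum_le_sum fun i _ => Finset.sum_le_sum fun j _ => ?_
  set a := hA'.isHermitian.eigenvalues i
  set b := hB'.isHermitian.eigenvalues j
  have ha : 0 ≤ a := hA'.eigenvalues_nonneg i
  have hb : 0 ≤ b := hB'.eigenvalues_nonneg j
  have young : (1 + p) * (a * b ^ p) ≤ a ^ (1 + p) + p * b ^ (1 + p) := by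
    have hconj : (1 + p).HolderConjugate ((1 + p) / p) := by
      rw [Real.holderConjugate_iff]
      constructor
      · linarith
      · field_simp
    have := Real.young_inequality_of_nonneg ha (Real.rpow_nonneg hb p) hconj
    rw [← Real.rpow_mul hb, mul_div_cancel₀ _ hp.ne'] at this
    calc _ ≤ (1 + p) * (a ^ (1 + p) / (1 + p) + b ^ (1 + p) / ((1 + p) / p)) := by gcongr
      _ = _ := by field_simp
  nlinarith [mul_le_mul_of_nonneg_left young (hw i j)]

section Pinching

variable {ι : Type*} [Fintype ι] {P : ι → Matrix n n ℂ}

theorem le_card_smul_sum_conj (hP : ∀ i, star (P i) = P i) (hP1 : ∑ i, P i = 1)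
    {X : Matrix n n ℂ} (hX : 0 ≤ X) :
    X ≤ (Fintype.card ι : ℝ) • ∑ i, P i * X * P i := by
  have h (i j : ι) : 0 ≤ (P i - P j) * X * (P i - P j) := by
    have := star_left_conjugate_nonneg hX (P i - P j)
    rwa [star_sub, hP, hP] at this
  have hcross : ∑ i, ∑ j, P i * X * P j = X := by
    simp_rw [← Finset.mul_sum, hP1, ← Finset.sum_mul, hP1, one_mul, mul_one]
  have hcross' : ∑ i, ∑ j, P j * X * P i = X := by
    rw [Finset.sum_comm, hcross]
  have hsum : ∑ i, ∑ j, (P i - P j) * X * (P i - P j) =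
      (2 : ℝ) • ((Fintype.card ι : ℝ) • (∑ i, P i * X * P i) - X) := by
    simp only [sub_mul, mul_sub, Finset.sum_sub_distrib, hcross, hcross', Finset.sum_const,
      Finset.card_univ, ← Finset.smul_sum, ← Nat.cast_smul_eq_nsmul ℝ]
    module
  have h0 : (0 : Matrix n n ℂ) ≤
      (2 : ℝ) • ((Fintype.card ι : ℝ) • (∑ i, P i * X * P i) - X) :=
    hsum ▸ Finset.sum_nonneg fun i _ => Finset.sum_nonneg fun j _ => h i j
  have h1 := smul_nonneg (show (0 : ℝ) ≤ 1 / 2 by norm_num) h0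
  rw [smul_smul] at h1
  norm_num at h1
  exact h1

variable [DecidableEq ι]

theorem sum_conj_mul (hPP : ∀ i j, P i * P j = if i = j then P i else 0) (X : Matrix n n ℂ)
    (i : ι) : (∑ j, P j * X * P j) * P i = P i * X * P i := by
  simp [Finset.sum_mul, mul_assoc, hPP]

theorem mul_sum_conj (hPP : ∀ i j, P i * P j = if i = j then P i else 0) (X : Matrix n n ℂ)
    (i : ι) : P i * (∑ j, P j * X * P j) = P i * X * P i := by
  simp [Finset.mul_sum, ← mul_assoc, hPP]

theorem trace_mul_sum_conj_rpow (hP : ∀ i, star (P i) = P i) (hP1 : ∑ i, P i = 1)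
    (hPP : ∀ i j, P i * P j = if i = j then P i else 0) {X : Matrix n n ℂ} (hX : 0 ≤ X)
    {p : ℝ} (hp : 0 < p) :
    (X * (∑ i, P i * X * P i) ^ p).trace = ((∑ i, P i * X * P i) ^ (1 + p)).trace := by
  have hE := sum_conj_nonneg hP hX
  set E := ∑ i, P i * X * P i with hE'
  have hcomm (i : ι) : Commute (E ^ p) (P i) :=
    Commute.cfc_nnreal ((sum_conj_mul hPP X i).trans (mul_sum_conj hPP X i).symm) _
  rw [← CFC.mul_rpow_self hE hp]
  nth_rw 2 [hE']
  rw [Finset.sum_mul, trace_sum]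
  have (i : ι) : (P i * X * P i * E ^ p).trace = (X * E ^ p * P i).trace := by
    rw [mul_assoc, mul_assoc, trace_mul_comm, mul_assoc X, mul_assoc, mul_assoc, (hcomm i).eq,
      ← mul_assoc (P i), hPP, if_pos rfl]
  simp_rw [this]
  rw [← trace_sum, ← Finset.mul_sum, hP1, mul_one]

theorem re_trace_sum_conj_rpow_le (hP : ∀ i, star (P i) = P i) (hP1 : ∑ i, P i = 1)
    (hPP : ∀ i j, P i * P j = if i = j then P i else 0) {X : Matrix n n ℂ} (hX : 0 ≤ X)
    {p : ℝ} (hp : 0 < p) :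
    ((∑ i, P i * X * P i) ^ (1 + p)).trace.re ≤ (X ^ (1 + p)).trace.re := by
  have h := re_trace_mul_rpow_le hX (sum_conj_nonneg hP hX) hp
  rw [trace_mul_sum_conj_rpow hP hP1 hPP hX hp] at h
  linarith

theorem re_trace_mul_smul_add_rpow_le (hP : ∀ i, star (P i) = P i) (hP1 : ∑ i, P i = 1)
    (hPP : ∀ i j, P i * P j = if i = j then P i else 0) {X Y : Matrix n n ℂ} (hX : 0 ≤ X)
    (hY : 0 ≤ Y) {y : ι → ℂ} (hPY : ∀ i, P i * Y = y i • P i) (hYP : ∀ i, Y * P i = y i • P i)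
    {c p : ℝ} (hc : 0 ≤ c) (hp : p ∈ Set.Ioc (0 : ℝ) 1) :
    (X * (c • X + Y) ^ p).trace.re ≤
      (X * Y ^ p).trace.re + (c * Fintype.card ι) ^ p * (X ^ (1 + p)).trace.re := by
  have hE := sum_conj_nonneg hP hX
  have hEX := le_card_smul_sum_conj hP hP1 hX
  have hcomm : Commute (∑ i, P i * X * P i) Y := by
    refine Commute.sum_left _ _ _ fun i _ => ?_
    rw [commute_iff_eq, mul_assoc _ (P i) Y, hPY, ← mul_assoc Y, ← mul_assoc Y, hYP]
    simp [mul_assoc]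
  have hle : (c • X + Y) ^ p ≤
      (c * Fintype.card ι) ^ p • (∑ i, P i * X * P i) ^ p + Y ^ p := by
    refine (CFC.rpow_le_rpow ⟨hp.1.le, hp.2⟩ ?_).trans
      (CFC.smul_add_rpow_le_of_commute hE hY hcomm (by positivity) hp)
    rw [mul_smul]
    gcongr
  refine (re_trace_mul_le_re_trace_mul hX hle).trans ?_
  rw [mul_add, mul_smul_comm, trace_add, trace_smul, trace_mul_sum_conj_rpow hP hP1 hPP hX hp.1,
    Complex.add_re, Complex.smul_re, add_comm, smul_eq_mul]
  have := re_trace_sum_conj_rpow_le hP hP1 hPP hX hp.1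
  exact add_le_add le_rfl (mul_le_mul_of_nonneg_left this (by positivity))

end Pinching

section SpectralProj

variable {A : Matrix n n ℂ} (hA : A.IsHermitian)

theorem star_spectralProj (t : ℝ) : star (spectralProj A hA t) = spectralProj A hA t := by
  have h : star (diagonal fun i => if hA.eigenvalues i = t then (1 : ℂ) else 0) =
      diagonal fun i => if hA.eigenvalues i = t then (1 : ℂ) else 0 := by
    rw [star_eq_conjTranspose, diagonal_conjTranspose]
    congr 1
    ext i
    simp [apply_ite]
  simp only [spectralProj, star_mul, star_star, h, mul_assoc]

theorem conj_eigenvectorUnitary_mul (f g : n → ℂ) :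
    (hA.eigenvectorUnitary : Matrix n n ℂ) * diagonal f *
        star (hA.eigenvectorUnitary : Matrix n n ℂ) *
      ((hA.eigenvectorUnitary : Matrix n n ℂ) * diagonal g *
        star (hA.eigenvectorUnitary : Matrix n n ℂ)) =
      (hA.eigenvectorUnitary : Matrix n n ℂ) * diagonal (fun i => f i * g i) *
        star (hA.eigenvectorUnitary : Matrix n n ℂ) := by
  have h : star (hA.eigenvectorUnitary : Matrix n n ℂ) * (hA.eigenvectorUnitary : Matrix n n ℂ) = 1 :=
    Unitary.coe_star_mul_self _
  rw [← diagonal_mul_diagonal]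
  simp only [mul_assoc]
  rw [← mul_assoc (star (hA.eigenvectorUnitary : Matrix n n ℂ)), h, one_mul]

theorem spectralProj_mul_spectralProj (s t : ℝ) :
    spectralProj A hA s * spectralProj A hA t = if s = t then spectralProj A hA s else 0 := by
  rw [spectralProj, spectralProj, conj_eigenvectorUnitary_mul]
  split_ifs with h
  · subst h
    congr 3
    ext i
    by_cases h1 : hA.eigenvalues i = s <;> simp [h1]
  · have : (fun i => (if hA.eigenvalues i = s then (1 : ℂ) else 0) *
        if hA.eigenvalues i = t then (1 : ℂ) else 0) = 0 := by
      ext i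
      by_cases h1 : hA.eigenvalues i = s <;> by_cases h2 : hA.eigenvalues i = t <;>
        simp_all
    rw [this]
    simp

theorem sum_spectralProj_s3 : ∑ t : (Finset.univ.image hA.eigenvalues : Finset ℝ),
    spectralProj A hA t = 1 := by
  simp only [spectralProj]
  rw [← Finset.sum_mul, ← Finset.mul_sum]
  have : ∑ t : (Finset.univ.image hA.eigenvalues : Finset ℝ),
      diagonal (fun i => if hA.eigenvalues i = t then (1 : ℂ) else 0) = 1 := by
    rw [Finset.sum_coe_sort (Finset.univ.image hA.eigenvalues)
      (fun t => diagonal (fun i => if hA.eigenvalues i = t then (1 : ℂ) else 0))]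
    ext i j
    rw [sum_apply]
    by_cases h : i = j
    · subst h
      simp
    · simp [h]
  rw [this, mul_one]
  exact Unitary.coe_mul_star_self _

theorem spectralProj_mul_cfc (f : ℝ → ℝ) (t : ℝ) :
    spectralProj A hA t * cfc f A = (f t : ℂ) • spectralProj A hA t := by
  rw [hA.cfc_eq_mul_diagonal_mul_star, spectralProj, conj_eigenvectorUnitary_mul, ← smul_mul_assoc,
    ← mul_smul_comm, ← diagonal_smul]
  congr 3
  ext i
  by_cases h1 : hA.eigenvalues i = t <;> simp [h1]

theorem cfc_mul_spectralProj (f : ℝ → ℝ) (t : ℝ) :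
    cfc f A * spectralProj A hA t = (f t : ℂ) • spectralProj A hA t := by
  rw [hA.cfc_eq_mul_diagonal_mul_star, spectralProj, conj_eigenvectorUnitary_mul, ← smul_mul_assoc,
    ← mul_smul_comm, ← diagonal_smul]
  congr 3
  ext i
  by_cases h1 : hA.eigenvalues i = t <;> simp [h1]

theorem matPow_eq_rpow (hA : 0 ≤ A) {r : ℝ} (hr : r ≠ 0) : matPow A r = A ^ r := by
  have hH : A.IsHermitian := (nonneg_iff_posSemidef.1 hA).isHermitian
  have h : A ^ r = cfc (fun x : ℝ => x ^ r) A := CFC.rpow_eq_cfc_real hA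
  rw [h, hH.cfc_eq, matPow, dif_pos hH]
  have : (fun i => (rpow0 (hH.eigenvalues i) r : ℂ)) =
      fun i => ((hH.eigenvalues i ^ r : ℝ) : ℂ) := by
    ext i
    by_cases h0 : hH.eigenvalues i = 0
    · simp [rpow0, h0, Real.zero_rpow hr]
    · simp [rpow0, h0]
  rw [this]
  rfl

end SpectralProj

section Averaging

variable {V : Type*} [Fintype V]

theorem sum_prod_smul_eq_sum_insertNth {M : Type*} [AddCommGroup M] [Module ℝ M] {m : ℕ}
    (q : V → ℝ) (G : (Fin (m + 1) → V) → M) (l : Fin (m + 1)) :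
    ∑ w : Fin (m + 1) → V, (∏ k, q (w k)) • G w =
      ∑ a, q a • ∑ w : Fin m → V, (∏ k, q (w k)) • G (Fin.insertNth l a w) := by
  rw [← (Fin.insertNthEquiv (fun _ => V) l).sum_comp, Fintype.sum_prod_type]
  refine Finset.sum_congr rfl fun a _ => ?_
  rw [Finset.smul_sum]
  refine Finset.sum_congr rfl fun w _ => ?_
  rw [Fin.prod_univ_succAbove _ l, smul_smul]
  simp
  rfl

theorem sum_prod_eq_one {q : V → ℝ} (hq1 : ∑ a, q a = 1) (m : ℕ) :
    ∑ w : Fin m → V, ∏ k, q (w k) = 1 := by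
  rw [← Fintype.sum_pow, hq1, one_pow]

theorem sum_prod_smul_apply {M : Type*} [AddCommGroup M] [Module ℝ M] {m : ℕ} {q : V → ℝ}
    (hq1 : ∑ a, q a = 1) (X : V → M) (l : Fin m) :
    ∑ w : Fin m → V, (∏ k, q (w k)) • X (w l) = ∑ a, q a • X a := by
  cases m with
  | zero => exact l.elim0
  | succ m =>
    rw [sum_prod_smul_eq_sum_insertNth q (fun w => X (w l)) l]
    simp [← Finset.sum_smul, sum_prod_eq_one hq1]

theorem sum_prod_smul_rpow_le {q : V → ℝ} (hq0 : ∀ a, 0 ≤ q a) (hq1 : ∑ a, q a = 1)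
    {X : V → Matrix n n ℂ} (hX : ∀ a, 0 ≤ X a) (m : ℕ) {Z : Matrix n n ℂ} (hZ : 0 ≤ Z) {p : ℝ}
    (hp : p ∈ Set.Icc (0 : ℝ) 1) :
    ∑ w : Fin m → V, (∏ k, q (w k)) • ((1 / (m + 1 : ℝ)) • (Z + ∑ k, X (w k))) ^ p ≤
      ((1 / (m + 1 : ℝ)) • Z + ∑ a, q a • X a) ^ p := by
  have hjensen := (CFC.concaveOn_rpow (A := Matrix n n ℂ) hp).le_map_sum (t := Finset.univ)
    (w := fun w : Fin m → V => ∏ k, q (w k))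
    (p := fun w => (1 / (m + 1 : ℝ)) • (Z + ∑ k, X (w k)))
    (fun w _ => Finset.prod_nonneg fun k _ => hq0 _) (sum_prod_eq_one hq1 m)
    (fun w _ => smul_nonneg (by positivity)
      (add_nonneg hZ (Finset.sum_nonneg fun k _ => hX _)))
  refine hjensen.trans (CFC.rpow_le_rpow hp ?_)
  have hY : 0 ≤ ∑ a, q a • X a := Finset.sum_nonneg fun a _ => smul_nonneg (hq0 a) (hX a)
  have hmean : ∑ w : Fin m → V, (∏ k, q (w k)) • (1 / (m + 1 : ℝ)) • (Z + ∑ k, X (w k)) =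
      (1 / (m + 1 : ℝ)) • Z + (m / (m + 1 : ℝ)) • ∑ a, q a • X a := by
    simp_rw [smul_comm _ (1 / (m + 1 : ℝ)), ← Finset.smul_sum, smul_add,
      Finset.sum_add_distrib, ← Finset.sum_smul, sum_prod_eq_one hq1 m, Finset.smul_sum]
    rw [Finset.sum_comm]
    simp_rw [← Finset.smul_sum, sum_prod_smul_apply hq1 X]
    rw [one_smul, Finset.sum_const, Finset.card_univ, Fintype.card_fin,
      ← Nat.cast_smul_eq_nsmul ℝ, smul_add, smul_smul]
    congr 2
    ring
  rw [hmean]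
  gcongr
  calc _ ≤ (1 : ℝ) • ∑ a, q a • X a := by
        gcongr
        rw [div_le_one (by positivity)]
        linarith
    _ = _ := one_smul _ _

theorem sum_prod_mul_re_trace_rpow_le {ι : Type*} [Fintype ι] [DecidableEq ι]
    {P : ι → Matrix n n ℂ} (hP : ∀ i, star (P i) = P i) (hP1 : ∑ i, P i = 1)
    (hPP : ∀ i j, P i * P j = if i = j then P i else 0)
    {q : V → ℝ} (hq0 : ∀ a, 0 ≤ q a) (hq1 : ∑ a, q a = 1)
    {X : V → Matrix n n ℂ} (hX : ∀ a, 0 ≤ X a) {Y : Matrix n n ℂ} (hY : Y = ∑ a, q a • X a)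
    {y : ι → ℂ} (hPY : ∀ i, P i * Y = y i • P i) (hYP : ∀ i, Y * P i = y i • P i)
    {L : ℕ} (hL : 1 ≤ L) {p : ℝ} (hp : p ∈ Set.Ioc (0 : ℝ) 1) :
    ∑ w : Fin L → V, (∏ k, q (w k)) *
        (((1 / (L : ℝ)) • ∑ k, X (w k)) ^ (1 + p)).trace.re ≤
      ∑ a, q a * ((X a * Y ^ p).trace.re +
        (1 / (L : ℝ) * Fintype.card ι) ^ p * (X a ^ (1 + p)).trace.re) := by
  obtain ⟨m, rfl⟩ : ∃ m, L = m + 1 := ⟨L - 1, by omega⟩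
  push_cast
  have hY0 : 0 ≤ Y := hY ▸ Finset.sum_nonneg fun a _ => smul_nonneg (hq0 a) (hX a)
  set T : (Fin (m + 1) → V) → Matrix n n ℂ :=
    fun w => (1 / (m + 1 : ℝ)) • ∑ k, X (w k) with hT
  have hT0 (w) : 0 ≤ T w :=
    smul_nonneg (by positivity) (Finset.sum_nonneg fun k _ => hX _)
  have hsplit (w) : (T w ^ (1 + p)).trace.re =
      (1 / (m + 1 : ℝ)) * ∑ l, (X (w l) * T w ^ p).trace.re := by
    rw [← CFC.mul_rpow_self (hT0 w) hp.1]
    nth_rw 1 [hT]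
    rw [smul_mul_assoc, trace_smul, Complex.smul_re, Finset.sum_mul, trace_sum, Complex.re_sum,
      smul_eq_mul]
  have hl (l : Fin (m + 1)) :
      ∑ w : Fin (m + 1) → V, (∏ k, q (w k)) * (X (w l) * T w ^ p).trace.re ≤
      ∑ a, q a * ((X a * Y ^ p).trace.re +
        (1 / (m + 1 : ℝ) * Fintype.card ι) ^ p * (X a ^ (1 + p)).trace.re) := by
    have h := sum_prod_smul_eq_sum_insertNth q (fun w => (X (w l) * T w ^ p).trace.re) l
    simp only [smul_eq_mul] at h
    rw [h]
    refine Finset.sum_le_sum fun a _ => mul_le_mul_of_nonneg_left ?_ (hq0 a)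
    refine le_trans ?_ (re_trace_mul_smul_add_rpow_le hP hP1 hPP (hX a) hY0 hPY hYP
      (by positivity) hp)
    refine le_trans (le_of_eq ?_) (re_trace_mul_le_re_trace_mul (hX a)
      (hY ▸ sum_prod_smul_rpow_le hq0 hq1 hX m (hX a) ⟨hp.1.le, hp.2⟩))
    rw [Finset.mul_sum, trace_sum, Complex.re_sum]
    refine Finset.sum_congr rfl fun w _ => ?_
    rw [mul_smul_comm, trace_smul, Complex.smul_re, smul_eq_mul, hT]
    simp [Fin.sum_univ_succAbove _ l]
  calc _ = (1 / (m + 1 : ℝ)) * ∑ l : Fin (m + 1),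
        ∑ w : Fin (m + 1) → V, (∏ k, q (w k)) * (X (w l) * T w ^ p).trace.re := by
        rw [Finset.sum_comm, Finset.mul_sum]
        refine Finset.sum_congr rfl fun w _ => ?_
        rw [hsplit, ← Finset.mul_sum]
        ring
    _ ≤ (1 / (m + 1 : ℝ)) * ∑ l : Fin (m + 1), ∑ a, q a * ((X a * Y ^ p).trace.re +
        (1 / (m + 1 : ℝ) * Fintype.card ι) ^ p * (X a ^ (1 + p)).trace.re) := by
        gcongr with l
        exact hl l
    _ = _ := by
        rw [Finset.sum_const, Finset.card_univ, Fintype.card_fin, nsmul_eq_mul]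
        push_cast
        field_simp

end Averaging

section Sandwiched

variable {σ : Matrix n n ℂ} {α : ℝ}

theorem PosDef.rpow_conj_self (hσ : σ.PosDef) (hα : 0 < α) :
    σ ^ (-α / (2 * (1 + α))) * σ * σ ^ (-α / (2 * (1 + α))) = σ ^ (1 / (1 + α)) := by
  have h0 : 0 ≤ σ := nonneg_iff_posSemidef.2 hσ.posSemidef
  have h1 : σ * σ ^ (-α / (2 * (1 + α))) = σ ^ (1 + -α / (2 * (1 + α))) := by
    rw [CFC.rpow_add hσ.isUnit, CFC.rpow_one σ h0]
  rw [mul_assoc, h1, ← CFC.rpow_add hσ.isUnit]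
  congr 1
  field_simp
  ring

theorem PosDef.trace_rpow_conj_mul (hσ : σ.PosDef) (hα : 0 < α) (A : Matrix n n ℂ) :
    (σ ^ (-α / (2 * (1 + α))) * A * σ ^ (-α / (2 * (1 + α))) *
      (σ ^ (1 / (1 + α))) ^ α).trace = A.trace := by
  have h0 : 0 ≤ σ := nonneg_iff_posSemidef.2 hσ.posSemidef
  rw [CFC.rpow_rpow σ _ _ (by positivity) hσ.isStrictlyPositive, mul_assoc, trace_mul_comm, ← mul_assoc,
    ← CFC.rpow_add hσ.isUnit, ← CFC.rpow_add hσ.isUnit]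
  have : -α / (2 * (1 + α)) + 1 / (1 + α) * α + -α / (2 * (1 + α)) = 0 := by
    field_simp
    ring
  rw [this, CFC.rpow_zero σ h0, one_mul]

theorem matPow_conj_eq_rpow (hσ : σ.PosDef) (hα : 0 < α) {A : Matrix n n ℂ} (hA : 0 ≤ A) :
    matPow (matPow σ (-α / (2 * (1 + α))) * A * matPow σ (-α / (2 * (1 + α)))) (1 + α) =
      (σ ^ (-α / (2 * (1 + α))) * A * σ ^ (-α / (2 * (1 + α)))) ^ (1 + α) := by
  have h0 : 0 ≤ σ := nonneg_iff_posSemidef.2 hσ.posSemidef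
  have hne : -α / (2 * (1 + α)) ≠ 0 := div_ne_zero (by linarith) (by positivity)
  have hS0 : 0 ≤ σ ^ (-α / (2 * (1 + α))) := CFC.rpow_nonneg
  have hne' : 1 + α ≠ 0 := by positivity
  rw [matPow_eq_rpow h0 hne]
  exact matPow_eq_rpow (conj_nonneg_of_nonneg hS0 hA) hne'

theorem two_rpow_mul_sandwichedRenyi {τ : Matrix n n ℂ} (hτ : IsDensityMatrix τ)
    (hσ : σ.PosDef) (hσ1 : σ.trace = 1) (hα : 0 < α) :
    (2 : ℝ) ^ (α * sandwichedRenyi (1 + α) τ σ) =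
      ((σ ^ (-α / (2 * (1 + α))) * τ * σ ^ (-α / (2 * (1 + α)))) ^ (1 + α)).trace.re := by
  have h0 : 0 ≤ σ := nonneg_iff_posSemidef.2 hσ.posSemidef
  have hτ0 : 0 ≤ τ := nonneg_iff_posSemidef.2 hτ.1
  have hyoung := re_trace_mul_rpow_le
    (conj_nonneg_of_nonneg (CFC.rpow_nonneg (a := σ) (y := -α / (2 * (1 + α)))) hτ0)
    (CFC.rpow_nonneg (a := σ) (y := 1 / (1 + α))) hα
  rw [hσ.trace_rpow_conj_mul hα, hτ.2, CFC.rpow_rpow σ _ _ (by positivity) hσ.isStrictlyPositive,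
    one_div_mul_cancel (by positivity), CFC.rpow_one σ h0, hσ1, Complex.one_re] at hyoung
  have hexp : (1 - (1 + α)) / (2 * (1 + α)) = -α / (2 * (1 + α)) := by ring
  rw [sandwichedRenyi, hexp, matPow_conj_eq_rpow hσ hα hτ0, add_sub_cancel_left, ← mul_assoc,
    mul_one_div_cancel hα.ne', one_mul, Real.rpow_logb two_pos (by norm_num) (by linarith)]

theorem isDensityMatrix_sum_smul {ι : Type*} [Fintype ι] {c : ι → ℝ} (hc0 : ∀ i, 0 ≤ c i)
    (hc1 : ∑ i, c i = 1) {ρ : ι → Matrix n n ℂ} (hρ : ∀ i, IsDensityMatrix (ρ i)) :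
    IsDensityMatrix (∑ i, c i • ρ i) := by
  constructor
  · exact nonneg_iff_posSemidef.1 (Finset.sum_nonneg fun i _ =>
      smul_nonneg (hc0 i) (nonneg_iff_posSemidef.2 (hρ i).1))
  · simp only [trace_sum, trace_smul, (hρ _).2, ← Finset.sum_smul, hc1, one_smul]

theorem sum_prod_mul_two_rpow_sandwichedRenyi_le {V : Type*} [Fintype V] {q : V → ℝ}
    (hq0 : ∀ a, 0 ≤ q a) (hq1 : ∑ a, q a = 1) {ρ : V → Matrix n n ℂ}
    (hρ : ∀ a, IsDensityMatrix (ρ a)) (hσ : σ = ∑ a, ((q a : ℝ) : ℂ) • ρ a) (hσpd : σ.PosDef)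
    (hα : α ∈ Set.Ioc (0 : ℝ) 1) {L : ℕ} (hL : 1 ≤ L) :
    ∑ w : Fin L → V, (∏ k, q (w k)) *
        (2 : ℝ) ^ (α * sandwichedRenyi (1 + α) (((1 / (L : ℝ) : ℝ) : ℂ) • ∑ k, ρ (w k)) σ) ≤
      1 + ((nEig σ : ℝ) ^ α / (L : ℝ) ^ α) * ∑ a, q a *
        (matPow (matPow σ (-α / (2 * (1 + α))) * ρ a *
          matPow σ (-α / (2 * (1 + α)))) (1 + α)).trace.re := by
  have hL0 : (0 : ℝ) < L := by exact_mod_cast hL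
  have h0 : 0 ≤ σ := nonneg_iff_posSemidef.2 hσpd.posSemidef
  have hρ0 (a) : 0 ≤ ρ a := nonneg_iff_posSemidef.2 (hρ a).1
  have hσ' : σ = ∑ a, q a • ρ a := by simpa only [Complex.coe_smul] using hσ
  have hσ1 : σ.trace = 1 := hσ' ▸ (isDensityMatrix_sum_smul hq0 hq1 hρ).2
  have hτ (w : Fin L → V) : IsDensityMatrix ((1 / (L : ℝ)) • ∑ k, ρ (w k)) := by
    rw [Finset.smul_sum]
    refine isDensityMatrix_sum_smul (fun _ => by positivity) ?_ fun k => hρ (w k)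
    simp [hL0.ne']
  set S := σ ^ (-α / (2 * (1 + α))) with hS
  have hS0 : 0 ≤ S := CFC.rpow_nonneg
  have hY : σ ^ (1 / (1 + α)) = ∑ a, q a • (S * ρ a * S) := by
    rw [← hσpd.rpow_conj_self hα.1, ← hS]
    nth_rw 1 [hσ']
    simp only [Finset.mul_sum, Finset.sum_mul, mul_smul_comm, smul_mul_assoc]
  have hcfc : σ ^ (1 / (1 + α)) = cfc (fun x : ℝ => x ^ (1 / (1 + α))) σ :=
    CFC.rpow_eq_cfc_real h0
  have hmain := sum_prod_mul_re_trace_rpow_le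
    (P := fun t : (Finset.univ.image hσpd.isHermitian.eigenvalues : Finset ℝ) =>
      spectralProj σ hσpd.isHermitian t)
    (fun t => star_spectralProj _ _) (sum_spectralProj_s3 _)
    (fun s t => by simp only [spectralProj_mul_spectralProj, Subtype.ext_iff])
    hq0 hq1 (fun a => conj_nonneg_of_nonneg hS0 (hρ0 a)) hY
    (fun t => by rw [hcfc]; exact spectralProj_mul_cfc _ _ _)
    (fun t => by rw [hcfc]; exact cfc_mul_spectralProj _ _ _) hL hα
  simp only [hS, hσpd.trace_rpow_conj_mul hα.1, (hρ _).2, Complex.one_re, Fintype.card_coe]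
    at hmain
  rw [← hS] at hmain
  have hcard : (Finset.univ.image hσpd.isHermitian.eigenvalues).card = nEig σ := by
    rw [nEig, dif_pos hσpd.isHermitian]
  calc _ = ∑ w : Fin L → V, (∏ k, q (w k)) *
        (((1 / (L : ℝ)) • ∑ k, S * ρ (w k) * S) ^ (1 + α)).trace.re := by
        refine Finset.sum_congr rfl fun w _ => ?_
        rw [Complex.coe_smul, two_rpow_mul_sandwichedRenyi (hτ w) hσpd hσ1 hα.1, ← hS]
        simp only [Finset.mul_sum, Finset.sum_mul, mul_smul_comm, smul_mul_assoc]
    _ ≤ _ := hmain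
    _ = _ := by
        simp only [matPow_conj_eq_rpow hσpd hα.1 (hρ0 _), ← hS]
        simp only [mul_add, mul_one, Finset.sum_add_distrib, hq1, hcard]
        rw [one_div_mul_eq_div, Real.div_rpow (by positivity) hL0.le, Finset.mul_sum]
        congr 1
        exact Finset.sum_congr rfl fun a _ => by ring

end Sandwiched

theorem re_trace_matPow_conj_nonneg {σ A : Matrix n n ℂ} (hσ : σ.PosDef) (hA : A.PosSemidef)
    {α : ℝ} (hα : 0 < α) :
    0 ≤ (matPow (matPow σ (-α / (2 * (1 + α))) * A *
      matPow σ (-α / (2 * (1 + α)))) (1 + α)).trace.re := by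
  rw [matPow_conj_eq_rpow hσ hα (nonneg_iff_posSemidef.2 hA)]
  exact re_trace_nonneg CFC.rpow_nonneg

end Matrix

end

/-- the exponentiated subcodebook average bound:
`E[2^{α D̃_{1+α}(τ‖σ^u)}] ≤ 1 + (ν₂^α / L^α) · K`. -/
theorem subcodebook_average_exponential_bound
    {V U : Type*} [Fintype V] [DecidableEq V] [Nonempty V]
    [Fintype U] [DecidableEq U] [Nonempty U]
    {n : Type*} [Fintype n] [DecidableEq n]
    (p : V × U → ℝ) (hp0 : ∀ vu, 0 ≤ p vu) (hp1 : ∑ vu : V × U, p vu = 1)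
    (pU : U → ℝ) (hpU : ∀ u, pU u = ∑ v : V, p (v, u)) (hpUpos : ∀ u, 0 < pU u)
    (pVU : V → U → ℝ) (hpVU : ∀ v u, pVU v u = p (v, u) / pU u)
    (ρ : V → U → Matrix n n ℂ) (hρ : ∀ v u, IsDensityMatrix (ρ v u))
    (σ : U → Matrix n n ℂ) (hσ : ∀ u, σ u = ∑ v : V, ((pVU v u : ℝ) : ℂ) • ρ v u)
    (hσpd : ∀ u, (σ u).PosDef)
    (α : ℝ) (hα : α ∈ Set.Ioo (0 : ℝ) (1/2))
    (L : ℕ) (hL : 1 ≤ L)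
    (ν₂ : ℕ) (hν₂ : ν₂ = Finset.univ.sup fun u : U => nEig (σ u))
    (τ : U → (Fin L → V) → Matrix n n ℂ)
    (hτ : ∀ u v, τ u v = ((1 / (L : ℝ) : ℝ) : ℂ) • ∑ ℓ : Fin L, ρ (v ℓ) u)
    (K : ℝ)
    (hK : K = ∑ vu : V × U, p vu *
      (matPow (matPow (σ vu.2) (-α / (2 * (1 + α))) * ρ vu.1 vu.2 *
        matPow (σ vu.2) (-α / (2 * (1 + α)))) (1 + α)).trace.re) :
    ∑ u : U, pU u * ∑ v : Fin L → V,
        (∏ ℓ : Fin L, pVU (v ℓ) u) *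
          (2 : ℝ) ^ (α * sandwichedRenyi (1 + α) (τ u v) (σ u)) ≤
      1 + ((ν₂ : ℝ) ^ α / (L : ℝ) ^ α) * K := by
  have hpp (v u) : pU u * pVU v u = p (v, u) := by
    rw [hpVU, mul_div_cancel₀ _ (hpUpos u).ne']
  have hq0 (u v) : 0 ≤ pVU v u := hpVU v u ▸ div_nonneg (hp0 _) (hpUpos u).le
  have hq1 (u) : ∑ v, pVU v u = 1 := by
    simp only [hpVU, ← Finset.sum_div]
    rw [← hpU, div_self (hpUpos u).ne']
  have hpU1 : ∑ u, pU u = 1 := by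
    rw [← hp1, Fintype.sum_prod_type_right]
    exact Finset.sum_congr rfl fun u _ => hpU u
  obtain ⟨k, hk⟩ : ∃ k : V → U → ℝ, ∀ v u, (matPow (matPow (σ u) (-α / (2 * (1 + α))) * ρ v u *
    matPow (σ u) (-α / (2 * (1 + α)))) (1 + α)).trace.re = k v u := ⟨_, fun _ _ => rfl⟩
  have hk0 (v u) : 0 ≤ k v u :=
    hk v u ▸ Matrix.re_trace_matPow_conj_nonneg (hσpd u) (hρ v u).1 hα.1
  simp only [hk] at hK
  have hu (u) : ∑ v : Fin L → V, (∏ ℓ : Fin L, pVU (v ℓ) u) *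
      (2 : ℝ) ^ (α * sandwichedRenyi (1 + α) (τ u v) (σ u)) ≤
      1 + ((ν₂ : ℝ) ^ α / (L : ℝ) ^ α) * ∑ v, pVU v u * k v u := by
    simp only [hτ]
    have h := Matrix.sum_prod_mul_two_rpow_sandwichedRenyi_le (hq0 u) (hq1 u) (hρ · u) (hσ u)
      (hσpd u) ⟨hα.1, by linarith [hα.2]⟩ hL
    simp only [hk] at h
    refine h.trans ?_
    have hν : nEig (σ u) ≤ ν₂ :=
      hν₂ ▸ Finset.le_sup (f := fun u => nEig (σ u)) (Finset.mem_univ u)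
    have hsum : 0 ≤ ∑ v, pVU v u * k v u :=
      Finset.sum_nonneg fun v _ => mul_nonneg (hq0 u v) (hk0 v u)
    have := hα.1
    gcongr
  calc _ ≤ ∑ u, pU u * (1 + ((ν₂ : ℝ) ^ α / (L : ℝ) ^ α) * ∑ v, pVU v u * k v u) :=
        Finset.sum_le_sum fun u _ => mul_le_mul_of_nonneg_left (hu u) (hpUpos u).le
    _ = 1 + ((ν₂ : ℝ) ^ α / (L : ℝ) ^ α) * K := by
        rw [hK, Fintype.sum_prod_type_right, Finset.mul_sum]
        simp only [mul_add, mul_one, Finset.sum_add_distrib, hpU1]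
        congr 1
        refine Finset.sum_congr rfl fun u _ => ?_
        rw [mul_left_comm, Finset.mul_sum]
        simp only [← mul_assoc, hpp]
end

section
/- Hayashi–Nagaoka operator inequality: let S and T be Hermitian d×d complex matrices with 0 ≤ S ≤ I and T ≥ 0, and suppose S + T is positive definite. Then I − (S+T)^{−1/2} S (S+T)^{−1/2} ≤ 2(I − S) + 4T in the Löwner order, where (S+T)^{−1/2} is the inverse of the positive definite square root of S+T. -/
open Matrix BigOperators
open scoped ComplexOrder

theorem rpow0_of_pos {x : ℝ} (hx : 0 < x) (r : ℝ) : rpow0 x r = x ^ r := by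
  simp [rpow0, hx.ne']

section matPow

variable {n : Type*} [Fintype n] [DecidableEq n] {A : Matrix n n ℂ}

theorem Matrix.PosDef.matPow_eq (hA : A.PosDef) (r : ℝ) :
    matPow A r = (hA.isHermitian.eigenvectorUnitary : Matrix n n ℂ) *
      Matrix.diagonal (fun i => ((hA.isHermitian.eigenvalues i ^ r : ℝ) : ℂ)) *
      star (hA.isHermitian.eigenvectorUnitary : Matrix n n ℂ) := by
  simp only [matPow, hA.isHermitian, dif_pos, rpow0_of_pos (hA.eigenvalues_pos _)]

theorem Matrix.PosDef.matPow_mul_matPow (hA : A.PosDef) (r s : ℝ) :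
    matPow A r * matPow A s = matPow A (r + s) := by
  have hU : star (hA.isHermitian.eigenvectorUnitary : Matrix n n ℂ) *
      hA.isHermitian.eigenvectorUnitary = 1 := Unitary.coe_star_mul_self _
  simp only [hA.matPow_eq, Real.rpow_add (hA.eigenvalues_pos _), Complex.ofReal_mul,
    ← Matrix.diagonal_mul_diagonal, mul_assoc]
  rw [← mul_assoc (star _) _ (_ * _), hU, one_mul]

theorem Matrix.PosDef.matPow_one (hA : A.PosDef) : matPow A 1 = A := by
  conv_rhs => rw [hA.isHermitian.spectral_theorem, Unitary.conjStarAlgAut_apply]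
  simp only [hA.matPow_eq, Real.rpow_one]
  rfl

theorem Matrix.PosDef.matPow_zero (hA : A.PosDef) : matPow A 0 = 1 := by
  simp [hA.matPow_eq]

theorem Matrix.PosDef.posDef_matPow (hA : A.PosDef) (r : ℝ) : (matPow A r).PosDef := by
  rw [hA.matPow_eq, Matrix.IsUnit.posDef_star_right_conjugate_iff
    (Unitary.isUnit_coe (U := hA.isHermitian.eigenvectorUnitary)), Matrix.posDef_diagonal_iff]
  exact fun i => by exact_mod_cast Real.rpow_pos_of_pos (hA.eigenvalues_pos i) r

end matPow

section LoewnerOrder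

variable {n : Type*} [Fintype n] [DecidableEq n] {S B : Matrix n n ℂ}

/-- Squaring reflects the Löwner order: `S² ≤ B²` implies `S ≤ B` for `S ≥ 0` and `B > 0`. -/
theorem Matrix.PosDef.posSemidef_sub_of_sq (hB : B.PosDef) (hS : S.PosSemidef)
    (h : (B * B - S * S).PosSemidef) : (B - S).PosSemidef := by
  have hD : (B - S).IsHermitian := hB.isHermitian.sub hS.isHermitian
  rw [hD.posSemidef_iff_eigenvalues_nonneg]
  intro i
  set v : n → ℂ := WithLp.ofLp (hD.eigenvectorBasis i)
  have hv0 : v ≠ 0 := by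
    intro h0
    exact hD.eigenvectorBasis.orthonormal.ne_zero i (by ext j; exact congrFun h0 j)
  have hDv : (B - S) *ᵥ v = (hD.eigenvalues i : ℂ) • v := by
    simpa using hD.mulVec_eigenvectorBasis i
  have hvD : star v ᵥ* (B - S) = (hD.eigenvalues i : ℂ) • star v := by
    have := congrArg star hDv
    rwa [star_mulVec, hD.eq, star_smul, RCLike.star_def, Complex.conj_ofReal] at this
  have hdecomp : (2 : ℂ) • (B * B - S * S) = (B - S) * (B + S) + (B + S) * (B - S) := by
    rw [two_smul]; noncomm_ring
  have hquad : star v ⬝ᵥ ((B * B - S * S) *ᵥ v) =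
      (hD.eigenvalues i : ℂ) * (star v ⬝ᵥ ((B + S) *ᵥ v)) := by
    have := congrArg (fun M => star v ⬝ᵥ (M *ᵥ v)) hdecomp
    simp only [add_mulVec _ _ v, smul_mulVec, dotProduct_add, dotProduct_smul, smul_eq_mul,
      ← mulVec_mulVec, hDv, mulVec_smul] at this
    rw [dotProduct_mulVec _ (B - S), hvD] at this
    simp only [add_mulVec, smul_dotProduct, dotProduct_add, smul_eq_mul] at this ⊢
    linear_combination this / 2
  have hnonneg := h.dotProduct_mulVec_nonneg v
  have hpos := (hB.add_posSemidef hS).dotProduct_mulVec_pos hv0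
  rw [hquad, Complex.le_def, Complex.re_ofReal_mul] at hnonneg
  exact nonneg_of_mul_nonneg_left hnonneg.1 (Complex.lt_def.mp hpos).1

theorem Matrix.PosSemidef.posSemidef_sub_mul_self (hS : S.PosSemidef)
    (hS1 : (1 - S).PosSemidef) : (S - S * S).PosSemidef := by
  have h₁ := hS1.mul_mul_conjTranspose_same S
  have h₂ := hS.mul_mul_conjTranspose_same (1 - S)
  rw [hS.isHermitian.eq] at h₁
  rw [hS1.isHermitian.eq] at h₂
  convert h₁.add h₂ using 1
  noncomm_ring

end LoewnerOrder

/-- the Hayashi–Nagaoka operator inequality: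
`I − (S+T)^{−1/2} S (S+T)^{−1/2} ≤ 2(I − S) + 4T` for `0 ≤ S ≤ I`, `T ≥ 0`,
`S + T` positive definite. -/
theorem hayashi_nagaoka
    {n : Type*} [Fintype n] [DecidableEq n]
    (S T : Matrix n n ℂ) (hS : S.PosSemidef) (hS1 : ((1 : Matrix n n ℂ) - S).PosSemidef)
    (hT : T.PosSemidef) (hST : (S + T).PosDef) :
    ((2 : ℂ) • ((1 : Matrix n n ℂ) - S) + (4 : ℂ) • T -
      ((1 : Matrix n n ℂ) - matPow (S + T) (-(1/2)) * S * matPow (S + T) (-(1/2)))).PosSemidef := by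
  set R := matPow (S + T) (-(1/2)) with hR
  set B := matPow (S + T) (1/2) with hB
  have hBB : B * B = S + T := by
    rw [hB, hST.matPow_mul_matPow, add_halves, hST.matPow_one]
  have hBR : B * R = 1 := by
    rw [hB, hR, hST.matPow_mul_matPow, add_neg_cancel, hST.matPow_zero]
  have hRB : R * B = 1 := by
    rw [hB, hR, hST.matPow_mul_matPow, neg_add_cancel, hST.matPow_zero]
  have hRA : R * S + R * T = B := by
    rw [← mul_add, ← hBB, ← mul_assoc, hRB, one_mul]
  have hAR : S * R + T * R = B := by
    rw [← add_mul, ← hBB, mul_assoc, hBR, mul_one]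
  have hRAR : R * S * R + R * T * R = 1 := by
    rw [← add_mul, hRA, hBR]
  have hRH : Rᴴ = R := (hST.posDef_matPow _).isHermitian.eq
  have hSB : (B - S).PosSemidef := by
    refine (hST.posDef_matPow _).posSemidef_sub_of_sq hS ?_
    rw [← hB, hBB]
    convert (hS.posSemidef_sub_mul_self hS1).add hT using 1
    abel
  have h₁ := hT.mul_mul_conjTranspose_same (R - (2 : ℂ) • 1)
  have h₂ := hS.mul_mul_conjTranspose_same (R - 1)
  simp only [conjTranspose_sub, conjTranspose_smul, conjTranspose_one, hRH, star_ofNat] at h₁ h₂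
  convert (h₁.add (h₂.smul (zero_le_two (α := ℂ)))).add
    (hSB.smul (zero_le_four (α := ℂ))) using 1
  simp only [sub_mul, mul_sub, smul_mul_assoc, mul_smul_comm, one_mul, mul_one]
  linear_combination (norm := module) (-1 : ℂ) • hRAR + (2 : ℂ) • hRA + (2 : ℂ) • hAR
end
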